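/- Let n and h be positive integers with n ≥ h and n+h even, let i be an integer with 1 ≤ i ≤ n−1, and let p(y) ∈ ℚ[y] be a polynomial with p(0) = 0. For a variable x, the operator (1+p(Δ_x)z)^{−1} := Σ_{m≥0} (−1)^m p(Δ_x)^m z^m is well defined on polynomials (the sum is finite on each polynomial since p has no constant term), and define Q(z; k_1,…,k_n) := ∏_{j=i+1}^n [(1 + p(δ_{k_j})z) ∘ (1 + p(Δ_{k_j})z)^{−1}] ḠT_h, an element of ℚ[k_1,…,k_n][z]. Then: (a) the degree of Q in z is at most h; (b) the degree in z of Σ_{j=i+1}^{n+1} (−1)^j · Q(z; k_1,…,k_{j−1},k_{j+1},…,k_{n+1}) is strictly less than h; and (c) the degree in z of Σ_{j=0}^{i} (−1)^j · Q(z; k_0,…,k_{j−1},k_{j+1},…,k_n) is strictly less than h. -/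

import Mathlib

open MvPolynomial

noncomputable section

/-- Index set of an `(h,n)`-trapezoidal array. -/
def GTIdx (h n : ℕ) : Type := {p : ℕ × ℕ // p.1 ≤ h ∧ p.2 < n - h + p.1}

def mkIdx (h n r c : ℕ) (hr : r ≤ h) (hc : c < n - h + r) : GTIdx h n := ⟨(r, c), hr, hc⟩

/-- The Gelfand–Tsetlin trapezoid conditions. -/
def IsGT (h n : ℕ) (a : GTIdx h n → ℤ) : Prop :=
  ∀ (r c : ℕ) (_ : r < h) (hc : c < n - h + r),
    a (mkIdx h n (r+1) c (by omega) (by omega)) ≤ a (mkIdx h n r c (by omega) hc) ∧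
    a (mkIdx h n r c (by omega) hc) ≤ a (mkIdx h n (r+1) (c+1) (by omega) (by omega))

/-- The number of `(h,n)`-Gelfand–Tsetlin trapezoids with prescribed bottom row `k`. -/
def GTcount (h n : ℕ) (k : Fin n → ℤ) : ℕ :=
  Nat.card {a : GTIdx h n → ℤ //
    IsGT h n a ∧ ∀ i : Fin n, a (mkIdx h n h i.val le_rfl (by have := i.isLt; omega)) = k i}

/-- We work in `R = (ℚ[z])[k_1,k_2,…]`: polynomials in the variables `k_1,…` (the variables
`X 0, X 1, …`) whose coefficients are polynomials in `z`. -/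
abbrev Rz : Type := MvPolynomial ℕ (Polynomial ℚ)

/-- The element `z` of `R`. -/
def zR : Rz := MvPolynomial.C Polynomial.X

/-- The shift operator `E_s`: substitute `X s + 1` for `X s`. -/
def shiftP (s : ℕ) (q : Rz) : Rz :=
  MvPolynomial.aeval (fun t => if t = s then MvPolynomial.X t + 1 else MvPolynomial.X t) q

/-- The forward difference operator `Δ_s = E_s - id`. -/
def fdiffP (s : ℕ) (q : Rz) : Rz := shiftP s q - q

/-- The inverse shift operator `E_s⁻¹`: substitute `X s - 1` for `X s`. -/
def shiftPinv (s : ℕ) (q : Rz) : Rz :=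
  MvPolynomial.aeval (fun t => if t = s then MvPolynomial.X t - 1 else MvPolynomial.X t) q

/-- The backward difference operator `δ_s = E_s⁻¹ - id`. -/
def bdiffP (s : ℕ) (q : Rz) : Rz := shiftPinv s q - q

/-- The operator `p(Δ_{X s})` for a univariate polynomial `p`. -/
def pApplyF (p : Polynomial ℚ) (s : ℕ) (q : Rz) : Rz :=
  ∑ m ∈ Finset.range (p.natDegree + 1),
    MvPolynomial.C (Polynomial.C (p.coeff m)) * (fdiffP s)^[m] q

/-- The operator `p(δ_{X s})` for a univariate polynomial `p`. -/
def pApplyB (p : Polynomial ℚ) (s : ℕ) (q : Rz) : Rz :=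
  ∑ m ∈ Finset.range (p.natDegree + 1),
    MvPolynomial.C (Polynomial.C (p.coeff m)) * (bdiffP s)^[m] q

/-- The operator `(1 + p(Δ_{X s}) z)⁻¹ = Σ_{m ≥ 0} (-1)^m p(Δ_{X s})^m z^m` (the sum is
finite on each polynomial, since `p` has no constant term). -/
def geomInv (p : Polynomial ℚ) (s : ℕ) (q : Rz) : Rz :=
  ∑ m ∈ Finset.range (q.totalDegree + 1),
    (-1 : Rz) ^ m * zR ^ m * (pApplyF p s)^[m] q

/-- The operator `(1 + p(δ_{X s}) z) ∘ (1 + p(Δ_{X s}) z)⁻¹`. -/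
def stepOp (p : Polynomial ℚ) (s : ℕ) (q : Rz) : Rz :=
  geomInv p s q + zR * pApplyB p s (geomInv p s q)

/-- `Q(z; k_1,…,k_n) = ∏_{j=i+1}^n [(1 + p(δ_{k_j}) z) ∘ (1 + p(Δ_{k_j}) z)⁻¹] g`, for a
polynomial `g` in the variables `k_1,…,k_n = X 0,…,X (n-1)` (the paper variable `k_j`
is the Lean variable `X (j-1)`; the commuting factors are applied in a fixed order). -/
def Qop (n i : ℕ) (p : Polynomial ℚ) (g : MvPolynomial ℕ ℚ) : Rz :=
  (List.range (n - i)).foldr (fun t q => stepOp p (i + t) q)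
    (MvPolynomial.map (Polynomial.C : ℚ →+* Polynomial ℚ) g)

/-- The antidifference of `g` that vanishes at `0`. -/
def antidiff (g : ℤ → ℚ) (x : ℤ) : ℚ := ∑ m ∈ Finset.Ico 0 x, g m - ∑ m ∈ Finset.Ico x 0, g m

/-- The signed sum of `g` over the half-open interval `[a, b)`. -/
def ssum (a b : ℤ) (g : ℤ → ℚ) : ℚ := antidiff g b - antidiff g a

theorem antidiff_succ (g : ℤ → ℚ) (x : ℤ) : antidiff g (x + 1) = antidiff g x + g x := by
  unfold antidiff
  rcases le_or_gt 0 x with hx | hx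
  · have : Finset.Ico 0 (x + 1) = insert x (Finset.Ico 0 x) := by
      ext m; simp only [Finset.mem_Ico, Finset.mem_insert]; omega
    rw [this, Finset.sum_insert (by simp), Finset.Ico_eq_empty_of_le hx,
      Finset.Ico_eq_empty_of_le (by omega : (0 : ℤ) ≤ x + 1)]
    simp [add_comm]
  · have : Finset.Ico x 0 = insert x (Finset.Ico (x + 1) 0) := by
      ext m; simp only [Finset.mem_Ico, Finset.mem_insert]; omega
    rw [this, Finset.sum_insert (by simp), Finset.Ico_eq_empty_of_le hx.le,
      Finset.Ico_eq_empty_of_le (by omega : x + 1 ≤ 0)]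
    simp

theorem ssum_self (a : ℤ) (g : ℤ → ℚ) : ssum a a g = 0 := sub_self _

theorem ssum_add_adjacent (a b c : ℤ) (g : ℤ → ℚ) : ssum a b g + ssum b c g = ssum a c g := by
  unfold ssum; ring

theorem ssum_symm (a b : ℤ) (g : ℤ → ℚ) : ssum b a g = -ssum a b g := by
  unfold ssum; ring

theorem ssum_succ_right (a b : ℤ) (g : ℤ → ℚ) : ssum a (b + 1) g = ssum a b g + g b := by
  unfold ssum; rw [antidiff_succ]; ring

theorem ssum_succ_left (a b : ℤ) (g : ℤ → ℚ) : ssum (a + 1) b g = ssum a b g - g a := by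
  unfold ssum; rw [antidiff_succ]; ring

theorem ssum_add (a b : ℤ) (g g' : ℤ → ℚ) :
    ssum a b (fun m => g m + g' m) = ssum a b g + ssum a b g' := by
  simp only [ssum, antidiff, Finset.sum_add_distrib]; ring

theorem ssum_neg (a b : ℤ) (g : ℤ → ℚ) : ssum a b (fun m => -g m) = -ssum a b g := by
  simp only [ssum, antidiff, Finset.sum_neg_distrib]; ring

theorem ssum_mul_left (a b : ℤ) (c : ℚ) (g : ℤ → ℚ) :
    ssum a b (fun m => c * g m) = c * ssum a b g := by
  simp only [ssum, antidiff, ← Finset.mul_sum]; ring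

theorem ssum_mul_right (a b : ℤ) (c : ℚ) (g : ℤ → ℚ) :
    ssum a b (fun m => g m * c) = ssum a b g * c := by
  simp only [ssum, antidiff, ← Finset.sum_mul]; ring

theorem antidiff_comm (a b : ℤ) (g : ℤ → ℤ → ℚ) :
    antidiff (fun u => antidiff (g u) b) a = antidiff (fun v => antidiff (fun u => g u v) a) b := by
  simp only [antidiff, Finset.sum_sub_distrib]
  rw [Finset.sum_comm (s := Finset.Ico 0 a) (t := Finset.Ico 0 b),
    Finset.sum_comm (s := Finset.Ico 0 a) (t := Finset.Ico b 0),
    Finset.sum_comm (s := Finset.Ico a 0) (t := Finset.Ico 0 b),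
    Finset.sum_comm (s := Finset.Ico a 0) (t := Finset.Ico b 0)]
  ring

theorem antidiff_sub (x : ℤ) (g g' : ℤ → ℚ) :
    antidiff (fun m => g m - g' m) x = antidiff g x - antidiff g' x := by
  simp only [antidiff, Finset.sum_sub_distrib]; ring

theorem ssum_comm (a b c d : ℤ) (g : ℤ → ℤ → ℚ) :
    ssum a b (fun u => ssum c d (g u)) = ssum c d (fun v => ssum a b (fun u => g u v)) := by
  simp only [ssum, antidiff_sub]
  rw [antidiff_comm b d, antidiff_comm b c, antidiff_comm a d, antidiff_comm a c]
  ring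

theorem ssum_shift (a b c : ℤ) (g : ℤ → ℚ) :
    ssum (a + c) (b + c) g = ssum a b (fun m => g (m + c)) := by
  have key : ∀ x, antidiff g (x + c) - antidiff (fun m => g (m + c)) x = antidiff g c := by
    intro x
    induction x using Int.induction_on with
    | zero => simp [antidiff]
    | succ k ih =>
      rw [antidiff_succ, show (k : ℤ) + 1 + c = k + c + 1 by ring, antidiff_succ]; linarith
    | pred k ih =>
      have h1 := antidiff_succ (fun m => g (m + c)) (-(k : ℤ) - 1)
      have h2 := antidiff_succ g (-(k : ℤ) - 1 + c)
      rw [show -(k : ℤ) - 1 + 1 = -k by ring] at h1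
      rw [show -(k : ℤ) - 1 + c + 1 = -k + c by ring] at h2
      linarith
  have h1 := key a
  have h2 := key b
  unfold ssum
  linarith

theorem ssum_eq_sum_Ico {a b : ℤ} (hab : a ≤ b) (g : ℤ → ℚ) :
    ssum a b g = ∑ m ∈ Finset.Ico a b, g m := by
  induction b, hab using Int.leInduction with
  | base => simp [ssum_self]
  | succ b hb ih =>
    have : Finset.Ico a (b + 1) = insert b (Finset.Ico a b) := by
      ext m; simp only [Finset.mem_Ico, Finset.mem_insert]; omega
    rw [ssum_succ_right, ih, this, Finset.sum_insert (by simp), add_comm]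

/-- The signed sum of a function of lists over all lists interlacing a given one: the `l`-th entry
runs over the half-open interval between two consecutive entries of the given list. -/
def interlaceSum : (List ℤ → ℚ) → List ℤ → ℚ
  | _, [] => 0
  | g, [_] => g []
  | g, x :: y :: l => ssum x y (fun m => interlaceSum (fun l' => g (m :: l')) (y :: l))

theorem interlaceSum_add (g g' : List ℤ → ℚ) (l : List ℤ) :
    interlaceSum (fun l => g l + g' l) l = interlaceSum g l + interlaceSum g' l := by
  induction l generalizing g g' with
  | nil => simp [interlaceSum]
  | cons x l ih =>
    cases l with
    | nil => simp [interlaceSum]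
    | cons y l => simp only [interlaceSum, ih, ssum_add]

theorem interlaceSum_mul_left (c : ℚ) (g : List ℤ → ℚ) (l : List ℤ) :
    interlaceSum (fun l => c * g l) l = c * interlaceSum g l := by
  induction l generalizing g with
  | nil => simp [interlaceSum]
  | cons x l ih =>
    cases l with
    | nil => simp [interlaceSum]
    | cons y l => simp only [interlaceSum, ih, ssum_mul_left]

theorem interlaceSum_append (g : List ℤ → ℚ) (l : List ℤ) (y z : ℤ) :
    interlaceSum g (l ++ [y, z]) =
      ssum y z (fun m => interlaceSum (fun l' => g (l' ++ [m])) (l ++ [y])) := by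
  induction l generalizing g with
  | nil => simp [interlaceSum]
  | cons a l ih =>
    cases l with
    | nil =>
      simp only [List.cons_append, List.nil_append, interlaceSum]
      rw [ssum_comm]
    | cons b l =>
      have h : ∀ m, interlaceSum (fun l' => g (m :: l')) (b :: l ++ [y, z]) = _ := fun m => ih _
      simp only [List.cons_append] at h ⊢
      simp only [interlaceSum, h]
      rw [ssum_comm]
      rfl

/-- Transposing two adjacent entries turns `g` into `-g`, up to a correction which is the product
of a function of the difference of these entries and a function of the other entries. -/
def IsAlmostAntisymm (g : List ℤ → ℚ) (f : ℤ → ℚ) (F : List ℤ → ℚ) : Prop :=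
  ∀ l₁ l₂ x y, g (l₁ ++ x :: y :: l₂) + g (l₁ ++ y :: x :: l₂) = f (y - x) * F (l₁ ++ l₂)

/-- The correction function for `interlaceSum g` in terms of the one for `g`. -/
def nextCorrection (f : ℤ → ℚ) (L : ℤ) : ℚ :=
  -(1 / 2) * ssum 0 L (fun u => ssum 0 L (fun v => f (v - u)))

theorem nextCorrection_zero (f : ℤ → ℚ) : nextCorrection f 0 = 0 := by
  simp [nextCorrection, ssum_self]

theorem nextCorrection_sub (f : ℤ → ℚ) (x y : ℤ) :
    nextCorrection f (y - x) = -(1 / 2) * ssum x y (fun u => ssum x y (fun v => f (v - u))) := by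
  have h := ssum_shift 0 (y - x) x (fun u => ssum (0 + x) (y - x + x) (fun v => f (v - u)))
  simp only [ssum_shift 0 (y - x) x (fun v => f (v - _)), add_sub_add_right_eq_sub] at h
  rw [zero_add, sub_add_cancel] at h
  rw [nextCorrection, ← h]
  congr 2
  funext u
  have h2 := ssum_shift 0 (y - x) x (fun v => f (v - u))
  rw [zero_add, sub_add_cancel] at h2
  rw [h2]

/-- The symmetric double sum of an almost antisymmetric function. -/
theorem ssum_ssum_of_almostAntisymm {g : ℤ → ℤ → ℚ} {f : ℤ → ℚ} {K : ℚ}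
    (h : ∀ u v, g u v + g v u = f (v - u) * K) (x y : ℤ) :
    -ssum x y (fun u => ssum x y (g u)) = nextCorrection f (y - x) * K := by
  have h1 : ssum x y (fun u => ssum x y (fun v => g u v + g v u)) =
      2 * ssum x y (fun u => ssum x y (g u)) := by
    simp only [ssum_add]
    rw [ssum_comm x y x y (fun u v => g v u)]
    ring
  simp only [h, ssum_mul_right] at h1
  rw [nextCorrection_sub]
  linarith

theorem ssum_right_of_almostAntisymm {g : ℤ → ℤ → ℚ} {f : ℤ → ℚ} {K : ℚ}
    (h : ∀ u v, g u v + g v u = f (v - u) * K) (x y b : ℤ) :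
    ssum x y (fun u => ssum y b (g u)) + ssum y x (fun u => ssum x b (g u)) =
      nextCorrection f (y - x) * K := by
  rw [← ssum_ssum_of_almostAntisymm h, ssum_symm x y]
  simp only [← ssum_add_adjacent x y b, ssum_add]
  ring

theorem ssum_left_of_almostAntisymm {g : ℤ → ℤ → ℚ} {f : ℤ → ℚ} {K : ℚ}
    (h : ∀ u v, g u v + g v u = f (v - u) * K) (a x y : ℤ) :
    ssum a x (fun u => ssum x y (g u)) + ssum a y (fun u => ssum y x (g u)) =
      nextCorrection f (y - x) * K := by
  rw [← ssum_ssum_of_almostAntisymm h]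
  simp only [ssum_symm x y (g _), ssum_neg]
  rw [← ssum_add_adjacent a x y]
  ring

theorem ssum_middle_of_almostAntisymm {g : ℤ → ℤ → ℤ → ℚ} {f K : ℤ → ℚ}
    (h₁ : ∀ u v w, g u v w + g v u w = f (v - u) * K w)
    (h₂ : ∀ u v w, g u v w + g u w v = f (w - v) * K u) (a b x y : ℤ) :
    ssum a x (fun u => ssum x y (fun v => ssum y b (g u v))) +
      ssum a y (fun u => ssum y x (fun v => ssum x b (g u v))) =
      nextCorrection f (y - x) * ssum a b K := by
  have e₁ : ssum x b (fun w => -ssum x y (fun u => ssum x y (fun v => g u v w))) =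
      nextCorrection f (y - x) * ssum x b K := by
    rw [← ssum_mul_left]
    congr 1
    funext w
    exact ssum_ssum_of_almostAntisymm (fun u v => h₁ u v w) x y
  have e₂ : ssum a x (fun u => -ssum x y (fun v => ssum x y (g u v))) =
      nextCorrection f (y - x) * ssum a x K := by
    rw [← ssum_mul_left]
    congr 1
    funext u
    exact ssum_ssum_of_almostAntisymm (fun v w => h₂ u v w) x y
  have e₃ : ssum x b (fun w => ssum x y (fun u => ssum x y (fun v => g u v w))) =
      ssum x y (fun u => ssum x y (fun v => ssum x b (g u v))) := by
    rw [ssum_comm]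
    congr 1
    funext u
    rw [ssum_comm]
  rw [ssum_neg] at e₁ e₂
  rw [e₃] at e₁
  rw [← ssum_add_adjacent a x b K, mul_add, ← e₁, ← e₂, ← ssum_add_adjacent a x y]
  have e₄ : ∀ u, ssum x y (fun v => ssum x b (g u v)) =
      ssum x y (fun v => ssum x y (g u v)) + ssum x y (fun v => ssum y b (g u v)) := by
    intro u
    simp only [← ssum_add_adjacent x y b, ssum_add]
  simp only [ssum_symm x y (fun v => ssum x b _), ssum_neg]
  simp only [e₄, ssum_add]
  ring

theorem IsAlmostAntisymm.cons {g F : List ℤ → ℚ} {f : ℤ → ℚ} (h : IsAlmostAntisymm g f F) (m : ℤ) :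
    IsAlmostAntisymm (fun l => g (m :: l)) f (fun l => F (m :: l)) :=
  fun l₁ l₂ x y => h (m :: l₁) l₂ x y

theorem interlaceSum_almostAntisymm_pair {g F : List ℤ → ℚ} {f : ℤ → ℚ}
    (h : IsAlmostAntisymm g f F) (l : List ℤ) (u v : ℤ) :
    interlaceSum (fun l' => g (u :: v :: l')) l + interlaceSum (fun l' => g (v :: u :: l')) l =
      f (v - u) * interlaceSum F l := by
  rw [← interlaceSum_add, ← interlaceSum_mul_left]
  congr 1
  funext l'
  exact h [] l' u v

theorem IsAlmostAntisymm.interlaceSum {g F : List ℤ → ℚ} {f : ℤ → ℚ}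
    (h : IsAlmostAntisymm g f F) :
    IsAlmostAntisymm (interlaceSum g) (nextCorrection f) (interlaceSum F) := by
  intro l₁ l₂ x y
  induction l₁ generalizing g F with
  | nil =>
    cases l₂ with
    | nil =>
      simp only [List.nil_append, _root_.interlaceSum]
      rw [ssum_symm x y]; ring
    | cons b l =>
      simp only [List.nil_append, _root_.interlaceSum]
      exact ssum_right_of_almostAntisymm
        (fun u v => interlaceSum_almostAntisymm_pair h (b :: l) u v) x y b
  | cons a l₁ ih =>
    cases l₁ with
    | nil =>
      cases l₂ with
      | nil =>
        simp only [List.nil_append, List.cons_append, _root_.interlaceSum]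
        exact ssum_left_of_almostAntisymm (fun u v => h [] [] u v) a x y
      | cons b l =>
        simp only [List.nil_append, List.cons_append, _root_.interlaceSum]
        refine ssum_middle_of_almostAntisymm (fun u v w => ?_) (fun u v w => ?_) a b x y
        · rw [← interlaceSum_add, ← interlaceSum_mul_left]
          congr 1
          funext l'
          exact h [] (w :: l') u v
        · exact interlaceSum_almostAntisymm_pair (h.cons u) (b :: l) v w
    | cons a' l₁ =>
      have e := fun m => ih (h.cons m)
      simp only [List.cons_append, _root_.interlaceSum] at e ⊢
      rw [← ssum_add, ← ssum_mul_left]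
      congr 1
      funext m
      exact e m

/-- The list version of the shifted Gelfand–Tsetlin trapezoid counting function. -/
def gtList : ℕ → List ℤ → ℚ
  | 0 => fun _ => 1
  | h + 1 => interlaceSum (gtList h)

theorem exists_almostAntisymm_gtList (h : ℕ) : ∃ f F, IsAlmostAntisymm (gtList h) f F := by
  induction h with
  | zero => exact ⟨fun _ => 2, fun _ => 1, fun l₁ l₂ x y => by simp [gtList]; norm_num⟩
  | succ h ih =>
    obtain ⟨f, F, hf⟩ := ih
    exact ⟨_, _, hf.interlaceSum⟩

section GeometricInverse

variable {A M : Type*} [CommRing A] [AddCommGroup M] [Module A M]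

/-- The operator `1 + b z` on formal power series in `z` with coefficients in a module. -/
def onePlusZ (b : A) (f : ℕ → M) : ℕ → M
  | 0 => f 0
  | m + 1 => f (m + 1) + b • f m

/-- The operator `(1 + a z)⁻¹` on formal power series in `z` with coefficients in a module. -/
def onePlusZInv (a : A) (f : ℕ → M) : ℕ → M
  | 0 => f 0
  | m + 1 => f (m + 1) - a • onePlusZInv a f m

/-- The operator `(1 + b z) ∘ (1 + a z)⁻¹` on formal power series in `z` with coefficients
in a module. -/
def ratioOp (a b : A) (f : ℕ → M) : ℕ → M := onePlusZ b (onePlusZInv a f)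

theorem onePlusZ_onePlusZInv (a : A) (f : ℕ → M) : onePlusZ a (onePlusZInv a f) = f := by
  funext m
  cases m <;> simp [onePlusZ, onePlusZInv]

theorem onePlusZInv_onePlusZ (a : A) (f : ℕ → M) : onePlusZInv a (onePlusZ a f) = f := by
  funext m
  induction m with
  | zero => simp [onePlusZ, onePlusZInv]
  | succ m ih => simp [onePlusZ, onePlusZInv, ih]

theorem onePlusZ_comm (a b : A) (f : ℕ → M) :
    onePlusZ a (onePlusZ b f) = onePlusZ b (onePlusZ a f) := by
  funext m
  rcases m with _ | _ | m
  · simp [onePlusZ]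
  · simp only [onePlusZ]; abel
  · simp only [onePlusZ, smul_add, smul_comm a b]; abel

theorem onePlusZ_onePlusZInv_comm (a b : A) (f : ℕ → M) :
    onePlusZ b (onePlusZInv a f) = onePlusZInv a (onePlusZ b f) := by
  rw [← onePlusZInv_onePlusZ a (onePlusZ b (onePlusZInv a f)), onePlusZ_comm,
    onePlusZ_onePlusZInv]

theorem onePlusZInv_comm (a b : A) (f : ℕ → M) :
    onePlusZInv a (onePlusZInv b f) = onePlusZInv b (onePlusZInv a f) := by
  rw [← onePlusZInv_onePlusZ b (onePlusZInv a (onePlusZInv b f)), onePlusZ_onePlusZInv_comm,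
    onePlusZ_onePlusZInv]

theorem ratioOp_comm (a b a' b' : A) (f : ℕ → M) :
    ratioOp a b (ratioOp a' b' f) = ratioOp a' b' (ratioOp a b f) := by
  unfold ratioOp
  rw [← onePlusZ_onePlusZInv_comm a b', onePlusZ_comm, onePlusZInv_comm,
    onePlusZ_onePlusZInv_comm a' b]

theorem onePlusZ_ratioOp (a b : A) (f : ℕ → M) : onePlusZ a (ratioOp a b f) = onePlusZ b f := by
  rw [ratioOp, onePlusZ_comm, onePlusZ_onePlusZInv]

theorem ratioOp_ratioOp_swap (a b : A) (f : ℕ → M) : ratioOp a b (ratioOp b a f) = f := by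
  rw [ratioOp, ratioOp, onePlusZInv_onePlusZ, onePlusZ_onePlusZInv]

theorem ratioOp_map {L : M → M} (hL : ∀ x y, L (x + y) = L x + L y) {a b a' b' : A}
    (ha : ∀ x, L (a • x) = a' • L x) (hb : ∀ x, L (b • x) = b' • L x) (f : ℕ → M) (m : ℕ) :
    L (ratioOp a b f m) = ratioOp a' b' (fun m => L (f m)) m := by
  have hsub : ∀ x y, L (x - y) = L x - L y := fun x y => (AddMonoidHom.mk' L hL).map_sub x y
  have key : ∀ m, L (onePlusZInv a f m) = onePlusZInv a' (fun m => L (f m)) m := by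
    intro m
    induction m with
    | zero => rfl
    | succ m ih => simp only [onePlusZInv, hsub, ha, ih]
  unfold ratioOp
  cases m with
  | zero => exact key 0
  | succ m => simp only [onePlusZ, hL, hb, key]

theorem ratioOp_add (a b : A) (f g : ℕ → M) : ratioOp a b (f + g) = ratioOp a b f + ratioOp a b g := by
  have key : ∀ m, onePlusZInv a (f + g) m = onePlusZInv a f m + onePlusZInv a g m := by
    intro m
    induction m with
    | zero => rfl
    | succ m ih => simp only [onePlusZInv, ih, Pi.add_apply, smul_add]; abel
  funext m
  unfold ratioOp
  cases m with
  | zero => exact key 0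
  | succ m => simp only [onePlusZ, key, Pi.add_apply, smul_add]; abel

theorem ratioOp_congr {S : AddSubgroup M} {a b a' b' : A} (haS : ∀ x ∈ S, a • x ∈ S)
    (ha : ∀ x ∈ S, a • x = a' • x) (hb : ∀ x ∈ S, b • x = b' • x) {f : ℕ → M}
    (hf : ∀ m, f m ∈ S) : ratioOp a b f = ratioOp a' b' f := by
  have key : ∀ m, onePlusZInv a f m = onePlusZInv a' f m ∧ onePlusZInv a f m ∈ S := by
    intro m
    induction m with
    | zero => exact ⟨rfl, hf 0⟩
    | succ m ih =>
      exact ⟨by simp only [onePlusZInv, ha _ ih.2, ← ih.1], S.sub_mem (hf _) (haS _ ih.2)⟩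
  funext m
  unfold ratioOp
  cases m with
  | zero => rfl
  | succ m => simp only [onePlusZ, ← (key _).1, hb _ (key m).2]

theorem ratioOp_zero (f : ℕ → M) : ratioOp (0 : A) 0 f = f := by
  funext m
  unfold ratioOp
  cases m with
  | zero => rfl
  | succ m => cases m <;> simp [onePlusZ, onePlusZInv]

theorem ratioOp_mem {S : AddSubgroup M} {a b : A} (ha : ∀ x ∈ S, a • x ∈ S)
    (hb : ∀ x ∈ S, b • x ∈ S) {f : ℕ → M} (hf : ∀ m, f m ∈ S) (m : ℕ) : ratioOp a b f m ∈ S := by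
  have key : ∀ m, onePlusZInv a f m ∈ S := by
    intro m
    induction m with
    | zero => exact hf 0
    | succ m ih => exact S.sub_mem (hf _) (ha _ ih)
  unfold ratioOp
  cases m with
  | zero => exact key 0
  | succ m => exact S.add_mem (key _) (hb _ (key _))

end GeometricInverse

/-- Functions on the lattice of integer sequences. -/
def LatFun : Type := (ℕ → ℤ) → ℚ

instance : AddCommGroup LatFun := inferInstanceAs (AddCommGroup ((ℕ → ℤ) → ℚ))

instance : Module ℚ LatFun := inferInstanceAs (Module ℚ ((ℕ → ℤ) → ℚ))

namespace LatFun

@[ext] theorem ext {f g : LatFun} (h : ∀ v, f v = g v) : f = g := funext h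

theorem add_apply (f g : LatFun) (v : ℕ → ℤ) : (f + g) v = f v + g v := rfl

theorem sub_apply (f g : LatFun) (v : ℕ → ℤ) : (f - g) v = f v - g v := rfl

theorem neg_apply (f : LatFun) (v : ℕ → ℤ) : (-f) v = -f v := rfl

theorem zero_apply (v : ℕ → ℤ) : (0 : LatFun) v = 0 := rfl

theorem smul_apply (c : ℚ) (f : LatFun) (v : ℕ → ℤ) : (c • f) v = c * f v := rfl

end LatFun

/-- The commutative algebra of difference operators with constant coefficients. -/
abbrev ShiftAlg : Type := AddMonoidAlgebra ℚ (ℕ → ℤ)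

/-- The action of lattice translations on functions. -/
def translation : Multiplicative (ℕ → ℤ) →* Module.End ℚ LatFun where
  toFun w :=
    { toFun := fun f v => f (v + w.toAdd)
      map_add' := fun _ _ => rfl
      map_smul' := fun _ _ => rfl }
  map_one' := by
    refine LinearMap.ext fun f => LatFun.ext fun v => ?_
    change f (v + 0) = f v
    rw [add_zero]
  map_mul' w w' := by
    refine LinearMap.ext fun f => LatFun.ext fun v => ?_
    change f (v + (w.toAdd + w'.toAdd)) = f (v + w.toAdd + w'.toAdd)
    rw [add_assoc]

instance : Module ShiftAlg LatFun :=
  Module.compHom LatFun (AddMonoidAlgebra.lift ℚ (Module.End ℚ LatFun) (ℕ → ℤ) translation).toRingHom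

theorem shiftAlg_smul_def (a : ShiftAlg) (f : LatFun) :
    a • f = AddMonoidAlgebra.lift ℚ (Module.End ℚ LatFun) (ℕ → ℤ) translation a f := rfl

instance : IsScalarTower ℚ ShiftAlg LatFun where
  smul_assoc c a f := by
    simp only [shiftAlg_smul_def, map_smul]
    rfl

theorem single_smul_apply (w : ℕ → ℤ) (c : ℚ) (f : LatFun) (v : ℕ → ℤ) :
    ((AddMonoidAlgebra.single w c : ShiftAlg) • f) v = c * f (v + w) := by
  rw [shiftAlg_smul_def, AddMonoidAlgebra.lift_single]
  rfl

/-- The operator translating the variable `s` by `c`. -/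
def shiftOp (s : ℕ) (c : ℤ) : ShiftAlg := AddMonoidAlgebra.single (Pi.single s c) 1

theorem shiftOp_smul_apply (s : ℕ) (c : ℤ) (f : LatFun) (v : ℕ → ℤ) :
    (shiftOp s c • f) v = f (v + Pi.single s c) := by
  rw [shiftOp, single_smul_apply, one_mul]

theorem shiftOp_mul_shiftOp (s : ℕ) (c d : ℤ) : shiftOp s c * shiftOp s d = shiftOp s (c + d) := by
  simp [shiftOp, AddMonoidAlgebra.single_mul_single, Pi.single_add]

theorem shiftOp_zero (s : ℕ) : shiftOp s 0 = 1 := by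
  simp [shiftOp, AddMonoidAlgebra.one_def]

/-- The difference operator `E_s ^ c - 1`. -/
def diffOp (s : ℕ) (c : ℤ) : ShiftAlg := shiftOp s c - 1

theorem diffOp_smul_apply (s : ℕ) (c : ℤ) (f : LatFun) (v : ℕ → ℤ) :
    (diffOp s c • f) v = f (v + Pi.single s c) - f v := by
  rw [diffOp, sub_smul, one_smul, LatFun.sub_apply, shiftOp_smul_apply]

theorem diffOp_neg_one (s : ℕ) : diffOp s (-1) = -shiftOp s (-1) * diffOp s 1 := by
  have h := shiftOp_mul_shiftOp s (-1) 1
  rw [neg_add_cancel, shiftOp_zero] at h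
  rw [diffOp, diffOp, mul_sub, neg_mul, h]
  ring

/-- The operator `p(E_s ^ c - 1)`. -/
def polyOp (p : Polynomial ℚ) (s : ℕ) (c : ℤ) : ShiftAlg := Polynomial.aeval (diffOp s c) p

theorem diffOp_dvd_polyOp {p : Polynomial ℚ} (hp : p.coeff 0 = 0) (s : ℕ) (c : ℤ) :
    diffOp s c ∣ polyOp p s c := by
  obtain ⟨q, rfl⟩ := Polynomial.X_dvd_iff.mpr hp
  exact ⟨Polynomial.aeval (diffOp s c) q, by simp [polyOp]⟩

theorem diffOp_one_dvd_polyOp_neg_one {p : Polynomial ℚ} (hp : p.coeff 0 = 0) (s : ℕ) :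
    diffOp s 1 ∣ polyOp p s (-1) :=
  (Dvd.intro_left _ (diffOp_neg_one s).symm).trans (diffOp_dvd_polyOp hp s (-1))

theorem smul_eq_zero_of_dvd {a b : ShiftAlg} (hab : a ∣ b) {f : LatFun} (hf : a • f = 0) :
    b • f = 0 := by
  obtain ⟨c, rfl⟩ := hab
  rw [mul_comm, mul_smul, hf, smul_zero]

theorem polyOp_smul (p : Polynomial ℚ) (s : ℕ) (c : ℤ) (f : LatFun) :
    polyOp p s c • f =
      ∑ m ∈ Finset.range (p.natDegree + 1), p.coeff m • diffOp s c ^ m • f := by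
  rw [polyOp, Polynomial.aeval_eq_sum_range, Finset.sum_smul]
  simp only [smul_assoc]

theorem diffOp_smul_mem {S : Submodule ℚ LatFun} {s : ℕ} {c : ℤ}
    (hS : ∀ f ∈ S, shiftOp s c • f ∈ S) {f : LatFun} (hf : f ∈ S) : diffOp s c • f ∈ S := by
  rw [diffOp, sub_smul, one_smul]
  exact S.sub_mem (hS f hf) hf

theorem polyOp_smul_mem {S : Submodule ℚ LatFun} {s : ℕ} {c : ℤ}
    (hS : ∀ f ∈ S, shiftOp s c • f ∈ S) (p : Polynomial ℚ) {f : LatFun} (hf : f ∈ S) :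
    polyOp p s c • f ∈ S := by
  rw [polyOp_smul]
  refine S.sum_mem fun m hm => S.smul_mem _ ?_
  clear hm
  induction m with
  | zero => simpa using hf
  | succ m ih =>
    rw [pow_succ', mul_smul]
    exact diffOp_smul_mem hS ih

/-- Precomposition with a map of the index set. -/
def reindex (σ : ℕ → ℕ) : LatFun →ₗ[ℚ] LatFun where
  toFun f v := f (v ∘ σ)
  map_add' _ _ := rfl
  map_smul' _ _ := rfl

theorem reindex_apply (σ : ℕ → ℕ) (f : LatFun) (v : ℕ → ℤ) : reindex σ f v = f (v ∘ σ) := rfl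

theorem reindex_shiftOp {σ : ℕ → ℕ} {s s' : ℕ} (h : ∀ t, σ t = s' ↔ t = s) (c : ℤ) (f : LatFun) :
    reindex σ (shiftOp s c • f) = shiftOp s' c • reindex σ f := by
  ext v
  rw [reindex_apply, shiftOp_smul_apply, shiftOp_smul_apply, reindex_apply]
  congr 1
  funext t
  simp only [Pi.add_apply, Function.comp_apply, Pi.single_apply, h]

theorem shiftOp_reindex {σ : ℕ → ℕ} {s : ℕ} (h : ∀ t, σ t ≠ s) (c : ℤ) (f : LatFun) :
    shiftOp s c • reindex σ f = reindex σ f := by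
  ext v
  rw [shiftOp_smul_apply, reindex_apply, reindex_apply]
  congr 1
  funext t
  simp [h]

theorem reindex_diffOp {σ : ℕ → ℕ} {s s' : ℕ} (h : ∀ t, σ t = s' ↔ t = s) (c : ℤ) (f : LatFun) :
    reindex σ (diffOp s c • f) = diffOp s' c • reindex σ f := by
  simp only [diffOp, sub_smul, one_smul, map_sub, reindex_shiftOp h]

theorem diffOp_reindex {σ : ℕ → ℕ} {s : ℕ} (h : ∀ t, σ t ≠ s) (c : ℤ) (f : LatFun) :
    diffOp s c • reindex σ f = 0 := by
  rw [diffOp, sub_smul, one_smul, shiftOp_reindex h, sub_self]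

theorem reindex_polyOp {σ : ℕ → ℕ} {s s' : ℕ} (h : ∀ t, σ t = s' ↔ t = s) (p : Polynomial ℚ)
    (c : ℤ) (f : LatFun) :
    reindex σ (polyOp p s c • f) = polyOp p s' c • reindex σ f := by
  have key : ∀ m, reindex σ (diffOp s c ^ m • f) = diffOp s' c ^ m • reindex σ f := by
    intro m
    induction m with
    | zero => simp
    | succ m ih => rw [pow_succ', mul_smul, reindex_diffOp h, ih, pow_succ', mul_smul]
  simp only [polyOp_smul, map_sum, map_smul, key]

/-- The operator `(1 + p(δ_s) z) ∘ (1 + p(Δ_s) z)⁻¹`. -/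
def stepSeq (p : Polynomial ℚ) (s : ℕ) (f : ℕ → LatFun) : ℕ → LatFun :=
  ratioOp (polyOp p s 1) (polyOp p s (-1)) f

theorem stepSeq_comm (p : Polynomial ℚ) (s t : ℕ) (f : ℕ → LatFun) :
    stepSeq p s (stepSeq p t f) = stepSeq p t (stepSeq p s f) := ratioOp_comm ..

theorem smul_stepSeq (p : Polynomial ℚ) (s : ℕ) (a : ShiftAlg) (f : ℕ → LatFun) (m : ℕ) :
    a • stepSeq p s f m = stepSeq p s (fun m => a • f m) m :=
  ratioOp_map (L := fun x => a • x) (smul_add a) (fun _ => smul_comm ..) (fun _ => smul_comm ..) f m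

theorem reindex_stepSeq {σ : ℕ → ℕ} {s s' : ℕ} (h : ∀ t, σ t = s' ↔ t = s) (p : Polynomial ℚ)
    (f : ℕ → LatFun) (m : ℕ) :
    reindex σ (stepSeq p s f m) = stepSeq p s' (fun m => reindex σ (f m)) m :=
  ratioOp_map (L := reindex σ) (map_add _) (reindex_polyOp h p 1) (reindex_polyOp h p (-1)) f m

theorem stepSeq_mem {S : Submodule ℚ LatFun} {s : ℕ}
    (hS : ∀ c, ∀ f ∈ S, shiftOp s c • f ∈ S) (p : Polynomial ℚ) {f : ℕ → LatFun}
    (hf : ∀ m, f m ∈ S) (m : ℕ) : stepSeq p s f m ∈ S :=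
  ratioOp_mem (S := S.toAddSubgroup) (fun _ h => polyOp_smul_mem (hS 1) p h)
    (fun _ h => polyOp_smul_mem (hS (-1)) p h) hf m

theorem stepSeq_eq_self {p : Polynomial ℚ} (hp : p.coeff 0 = 0) {s : ℕ} {f : ℕ → LatFun}
    (hf : ∀ m, diffOp s 1 • f m = 0) : stepSeq p s f = f := by
  let S : AddSubgroup LatFun := (DistribSMul.toAddMonoidHom LatFun (diffOp s 1)).ker
  have h1 : ∀ x ∈ S, polyOp p s 1 • x = (0 : ShiftAlg) • x := fun x hx => by
    rw [zero_smul]; exact smul_eq_zero_of_dvd (diffOp_dvd_polyOp hp s 1) hx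
  have h2 : ∀ x ∈ S, polyOp p s (-1) • x = (0 : ShiftAlg) • x := fun x hx => by
    rw [zero_smul]; exact smul_eq_zero_of_dvd (diffOp_one_dvd_polyOp_neg_one hp s) hx
  rw [stepSeq, ratioOp_congr (S := S) (fun x hx => ?_) h1 h2 hf, ratioOp_zero]
  rw [h1 x hx, zero_smul]
  exact S.zero_mem

theorem onePlusZ_stepSeq (p : Polynomial ℚ) (s : ℕ) (f : ℕ → LatFun) :
    onePlusZ (polyOp p s 1) (stepSeq p s f) = onePlusZ (polyOp p s (-1)) f := onePlusZ_ratioOp ..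

theorem stepSeq_add (p : Polynomial ℚ) (s : ℕ) (f g : ℕ → LatFun) :
    stepSeq p s (f + g) = stepSeq p s f + stepSeq p s g := ratioOp_add ..

/-- The operators on two variables cancel on functions that are invariant under a simultaneous
translation of both variables. -/
theorem stepSeq_stepSeq_eq_self (p : Polynomial ℚ) {s t : ℕ} {f : ℕ → LatFun}
    (hf : ∀ m, (shiftOp s 1 * shiftOp t 1 - 1) • f m = 0) : stepSeq p s (stepSeq p t f) = f := by
  have hdvd : ∀ {s t : ℕ} (c : ℤ), shiftOp s c * shiftOp t c - 1 ∣ polyOp p t c - polyOp p s (-c) := by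
    intro s t c
    have h1 : diffOp t c - diffOp s (-c) ∣ polyOp p t c - polyOp p s (-c) := by
      have := Polynomial.sub_dvd_eval_sub (diffOp t c) (diffOp s (-c))
        (p.map (algebraMap ℚ ShiftAlg))
      simpa only [polyOp, Polynomial.eval_map_algebraMap] using this
    refine Dvd.dvd.trans ⟨shiftOp s (-c), ?_⟩ h1
    have h := shiftOp_mul_shiftOp s (-c) c
    rw [neg_add_cancel, shiftOp_zero] at h
    linear_combination (norm := (simp only [diffOp]; ring)) (-shiftOp t c) * h
  let S : AddSubgroup LatFun :=
    (DistribSMul.toAddMonoidHom LatFun (shiftOp s 1 * shiftOp t 1 - 1)).ker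
  have hS : ∀ (a : ShiftAlg), ∀ x ∈ S, a • x ∈ S := by
    intro a x hx
    change (shiftOp s 1 * shiftOp t 1 - 1) • a • x = 0
    rw [smul_comm, show (shiftOp s 1 * shiftOp t 1 - 1) • x = 0 from hx, smul_zero]
  have h1 : ∀ x ∈ S, polyOp p t 1 • x = polyOp p s (-1) • x := fun x hx => by
    rw [← sub_eq_zero, ← sub_smul]
    exact smul_eq_zero_of_dvd (hdvd 1) hx
  have h2 : ∀ x ∈ S, polyOp p t (-1) • x = polyOp p s 1 • x := fun x hx => by
    rw [← sub_eq_zero, ← sub_smul, ← neg_sub, neg_smul, neg_eq_zero]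
    have := hdvd (s := t) (t := s) 1
    rw [mul_comm] at this
    exact smul_eq_zero_of_dvd this hx
  rw [stepSeq, stepSeq, ratioOp_congr (S := S) (hS _) h1 h2 hf, ratioOp_ratioOp_swap]

theorem shift_apply_of_diffOp_eq_zero {s : ℕ} {f : LatFun} (hf : diffOp s 1 • f = 0) (c : ℤ)
    (v : ℕ → ℤ) : f (v + Pi.single s c) = f v := by
  have h : ∀ v, f (v + Pi.single s 1) = f v := fun v => by
    have := congrFun hf v
    rw [diffOp_smul_apply, LatFun.zero_apply] at this
    linarith
  induction c using Int.induction_on with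
  | zero => simp
  | succ k ih => rw [Pi.single_add, ← add_assoc, h, ih]
  | pred k ih =>
    rw [← h, add_assoc, ← Pi.single_add, sub_add_cancel, ih]

/-- Functions that vanish when the variables `j` and `j + 1` agree. -/
def vanishing (j : ℕ) : Submodule ℚ LatFun where
  carrier := {f | ∀ v : ℕ → ℤ, v j = v (j + 1) → f v = 0}
  add_mem' hf hg v hv := by rw [LatFun.add_apply, hf v hv, hg v hv, add_zero]
  zero_mem' _ _ := rfl
  smul_mem' c f hf v hv := by rw [LatFun.smul_apply, hf v hv, mul_zero]

theorem shiftOp_smul_mem_vanishing {j s : ℕ} (h₁ : s ≠ j) (h₂ : s ≠ j + 1) (c : ℤ) (f : LatFun)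
    (hf : f ∈ vanishing j) : shiftOp s c • f ∈ vanishing j := by
  intro v hv
  rw [shiftOp_smul_apply]
  refine hf _ ?_
  simp [h₁.symm, h₂.symm, hv]

theorem eq_zero_of_vanishing_of_diffOp_left {j : ℕ} {f : LatFun} (hf : f ∈ vanishing j)
    (hd : diffOp j 1 • f = 0) : f = 0 := by
  ext v
  rw [← shift_apply_of_diffOp_eq_zero hd (v (j + 1) - v j) v]
  exact hf _ (by simp)

theorem eq_zero_of_vanishing_of_diffOp_right {j : ℕ} {f : LatFun} (hf : f ∈ vanishing j)
    (hd : diffOp (j + 1) 1 • f = 0) : f = 0 := by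
  ext v
  rw [← shift_apply_of_diffOp_eq_zero hd (v j - v (j + 1)) v]
  exact hf _ (by simp)

/-- The product of the forward differences in the variables `< a`. -/
def leftProd (a : ℕ) : ShiftAlg := ∏ l ∈ Finset.range a, diffOp l 1

/-- The product of the forward differences in the variables in `[a, n)`. -/
def rightProd (a n : ℕ) : ShiftAlg := ∏ l ∈ Finset.Ico a n, diffOp l 1

theorem leftProd_succ (a : ℕ) : leftProd (a + 1) = diffOp a 1 * leftProd a := by
  rw [leftProd, Finset.prod_range_succ, mul_comm, leftProd]

theorem rightProd_eq_mul {a n : ℕ} (h : a < n) :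
    rightProd a n = diffOp a 1 * rightProd (a + 1) n := by
  rw [rightProd, Finset.prod_eq_prod_Ico_succ_bot h, rightProd]

theorem prod_diffOp_smul_mem {S : Submodule ℚ LatFun} {T : Finset ℕ}
    (hS : ∀ s ∈ T, ∀ f ∈ S, shiftOp s 1 • f ∈ S) {f : LatFun} (hf : f ∈ S) :
    (∏ l ∈ T, diffOp l 1) • f ∈ S := by
  induction T using Finset.induction_on with
  | empty => simpa using hf
  | insert s T hs ih =>
    rw [Finset.prod_insert hs, mul_smul]
    exact diffOp_smul_mem (hS s (Finset.mem_insert_self s T))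
      (ih fun t ht => hS t (Finset.mem_insert_of_mem ht))

theorem leftProd_smul_mem_vanishing {a j : ℕ} (h : a ≤ j) {f : LatFun} (hf : f ∈ vanishing j) :
    leftProd a • f ∈ vanishing j :=
  prod_diffOp_smul_mem (fun s hs => by
    rw [Finset.mem_range] at hs
    exact shiftOp_smul_mem_vanishing (by omega) (by omega) 1) hf

theorem rightProd_smul_mem_vanishing {a n j : ℕ} (h : j + 2 ≤ a) {f : LatFun}
    (hf : f ∈ vanishing j) : rightProd a n • f ∈ vanishing j :=
  prod_diffOp_smul_mem (fun s hs => by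
    rw [Finset.mem_Ico] at hs
    exact shiftOp_smul_mem_vanishing (by omega) (by omega) 1) hf

theorem eq_zero_of_leftProd {i : ℕ} {f : LatFun} (hv : ∀ j < i, f ∈ vanishing j)
    (hd : leftProd i • f = 0) : f = 0 := by
  induction i with
  | zero => simpa [leftProd] using hd
  | succ i ih =>
    refine ih (fun j hj => hv j (by omega)) ?_
    refine eq_zero_of_vanishing_of_diffOp_left
      (leftProd_smul_mem_vanishing le_rfl (hv i (by omega))) ?_
    rw [← mul_smul, ← leftProd_succ, hd]

theorem eq_zero_of_rightProd {a n : ℕ} {f : LatFun}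
    (hv : ∀ j, a ≤ j → j + 1 < n → f ∈ vanishing j) (hd : rightProd (a + 1) n • f = 0) : f = 0 := by
  obtain ⟨k, hk⟩ : ∃ k, n ≤ a + 1 + k := ⟨n, by omega⟩
  induction k generalizing a with
  | zero => rwa [rightProd, Finset.Ico_eq_empty (by omega), Finset.prod_empty, one_smul] at hd
  | succ k ih =>
    rcases Nat.lt_or_ge (a + 1) n with h | h
    · refine ih (a := a + 1) (fun j hj => hv j (by omega)) ?_ (by omega)
      refine eq_zero_of_vanishing_of_diffOp_right
        (rightProd_smul_mem_vanishing le_rfl (hv a le_rfl h)) ?_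
      rw [← mul_smul, ← rightProd_eq_mul h, hd]
    · rwa [rightProd, Finset.Ico_eq_empty (by omega), Finset.prod_empty, one_smul] at hd

/-- Functions whose symmetrization in the variables `j` and `j + 1` is invariant under the
simultaneous translation of these variables, and vanishes when they agree. -/
def nearAntisymm (j : ℕ) : Submodule ℚ LatFun where
  carrier := {f | (shiftOp j 1 * shiftOp (j + 1) 1 - 1) • (f + reindex (Equiv.swap j (j + 1)) f) = 0 ∧
    f + reindex (Equiv.swap j (j + 1)) f ∈ vanishing j}
  add_mem' {f g} hf hg := by
    have e : f + g + reindex (Equiv.swap j (j + 1)) (f + g) =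
        (f + reindex (Equiv.swap j (j + 1)) f) + (g + reindex (Equiv.swap j (j + 1)) g) := by
      rw [map_add]; abel
    refine ⟨?_, ?_⟩
    · rw [e, smul_add, hf.1, hg.1, add_zero]
    · rw [e]
      exact Submodule.add_mem _ hf.2 hg.2
  zero_mem' := by simp
  smul_mem' c f hf := by
    refine ⟨?_, ?_⟩
    · rw [map_smul, ← smul_add, smul_comm, hf.1, smul_zero]
    · rw [map_smul, ← smul_add]
      exact Submodule.smul_mem _ _ hf.2

theorem nearAntisymm_le_vanishing (j : ℕ) : nearAntisymm j ≤ vanishing j := by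
  intro f hf v hv
  have h := hf.2 v hv
  rw [LatFun.add_apply, reindex_apply] at h
  have e : v ∘ Equiv.swap j (j + 1) = v := by
    funext t
    simp only [Function.comp_apply, Equiv.swap_apply_def]
    split_ifs with h1 h2
    · rw [h1, hv]
    · rw [h2, hv]
    · rfl
  rw [e] at h
  linarith

theorem swap_eq_iff_of_ne {j s : ℕ} (h₁ : s ≠ j) (h₂ : s ≠ j + 1) (t : ℕ) :
    Equiv.swap j (j + 1) t = s ↔ t = s := by
  rw [Equiv.swap_apply_eq_iff, Equiv.swap_apply_of_ne_of_ne h₁ h₂]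

theorem shiftOp_smul_mem_nearAntisymm {j s : ℕ} (h₁ : s ≠ j) (h₂ : s ≠ j + 1) (c : ℤ) (f : LatFun)
    (hf : f ∈ nearAntisymm j) : shiftOp s c • f ∈ nearAntisymm j := by
  refine ⟨?_, ?_⟩
  · rw [reindex_shiftOp (swap_eq_iff_of_ne h₁ h₂), ← smul_add, smul_comm, hf.1, smul_zero]
  · rw [reindex_shiftOp (swap_eq_iff_of_ne h₁ h₂), ← smul_add]
    exact shiftOp_smul_mem_vanishing h₁ h₂ c _ hf.2

theorem stepSeq_stepSeq_mem_nearAntisymm (p : Polynomial ℚ) {j : ℕ} {f : ℕ → LatFun}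
    (hf : ∀ m, f m ∈ nearAntisymm j) (m : ℕ) :
    stepSeq p j (stepSeq p (j + 1) f) m ∈ nearAntisymm j := by
  have e : stepSeq p j (stepSeq p (j + 1) f) m +
      reindex (Equiv.swap j (j + 1)) (stepSeq p j (stepSeq p (j + 1) f) m) =
      f m + reindex (Equiv.swap j (j + 1)) (f m) := by
    have h1 : ∀ t, Equiv.swap j (j + 1) t = j + 1 ↔ t = j := fun t => by
      rw [Equiv.swap_apply_eq_iff, Equiv.swap_apply_right]
    have h2 : ∀ t, Equiv.swap j (j + 1) t = j ↔ t = j + 1 := fun t => by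
      rw [Equiv.swap_apply_eq_iff, Equiv.swap_apply_left]
    rw [reindex_stepSeq h1]
    simp only [reindex_stepSeq h2]
    have h3 := congrFun (stepSeq_stepSeq_eq_self p (s := j) (t := j + 1)
      (f := f + fun m => reindex (Equiv.swap j (j + 1)) (f m)) fun m => (hf m).1) m
    rw [stepSeq_add, stepSeq_add] at h3
    rw [← Pi.add_apply f (fun m => reindex (Equiv.swap j (j + 1)) (f m)), ← h3, Pi.add_apply,
      ← stepSeq_comm p j (j + 1)]
  exact ⟨by rw [e]; exact (hf m).1, by rw [e]; exact (hf m).2⟩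

/-- The composition of the operators `stepSeq p s` for `i ≤ s < i + k`. -/
def stepRange (p : Polynomial ℚ) : ℕ → ℕ → (ℕ → LatFun) → ℕ → LatFun
  | _, 0, f => f
  | i, k + 1, f => stepSeq p i (stepRange p (i + 1) k f)

theorem stepRange_mem {S : Submodule ℚ LatFun}
    (hS : ∀ s c, ∀ f ∈ S, shiftOp s c • f ∈ S) (p : Polynomial ℚ) (i k : ℕ) {f : ℕ → LatFun}
    (hf : ∀ m, f m ∈ S) (m : ℕ) : stepRange p i k f m ∈ S := by
  induction k generalizing i m with
  | zero => exact hf m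
  | succ k ih => exact stepSeq_mem (hS i) p (fun m => ih (i + 1) m) m

theorem stepRange_add (p : Polynomial ℚ) (i k : ℕ) (f g : ℕ → LatFun) :
    stepRange p i k (f + g) = stepRange p i k f + stepRange p i k g := by
  induction k generalizing i with
  | zero => rfl
  | succ k ih => rw [stepRange, ih, stepSeq_add]; rfl

theorem smul_stepRange (p : Polynomial ℚ) (i k : ℕ) (a : ShiftAlg) (f : ℕ → LatFun) (m : ℕ) :
    a • stepRange p i k f m = stepRange p i k (fun m => a • f m) m := by
  induction k generalizing i m with
  | zero => rfl
  | succ k ih => simp only [stepRange, smul_stepSeq, ih]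

theorem stepRange_mem_nearAntisymm (p : Polynomial ℚ) {i k j : ℕ} {f : ℕ → LatFun}
    (hf : ∀ m, f m ∈ nearAntisymm j) (h : j + 1 < i ∨ i ≤ j ∧ j + 1 < i + k) (m : ℕ) :
    stepRange p i k f m ∈ nearAntisymm j := by
  induction k using Nat.strong_induction_on generalizing i m with
  | _ k ih =>
    rcases k with _ | k
    · exact hf m
    rcases eq_or_ne i j with rfl | hij
    · obtain ⟨k, rfl⟩ : ∃ k', k = k' + 1 := ⟨k - 1, by omega⟩
      exact stepSeq_stepSeq_mem_nearAntisymm p (fun m => ih k (by omega) (by omega) m) m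
    · exact stepSeq_mem (fun c => shiftOp_smul_mem_nearAntisymm hij (by omega) c) p
        (fun m => ih k (by omega) (by omega) m) m

/-- The increasing map `ℕ → ℕ` that misses exactly the value `j`. -/
def skipIdx (j t : ℕ) : ℕ := if t < j then t else t + 1

theorem skipIdx_ne (j t : ℕ) : skipIdx j t ≠ j := by unfold skipIdx; split_ifs <;> omega

theorem skipIdx_eq_succ_iff {j s : ℕ} (h : j ≤ s) (t : ℕ) : skipIdx j t = s + 1 ↔ t = s := by
  unfold skipIdx; split_ifs <;> omega

theorem skipIdx_eq_iff {j s : ℕ} (h : s < j) (t : ℕ) : skipIdx j t = s ↔ t = s := by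
  unfold skipIdx; split_ifs <;> omega

theorem stepRange_reindex_skipIdx (p : Polynomial ℚ) {i j : ℕ} (h : j ≤ i) (k : ℕ)
    (f : ℕ → LatFun) (m : ℕ) :
    stepRange p (i + 1) k (fun m => reindex (skipIdx j) (f m)) m =
      reindex (skipIdx j) (stepRange p i k f m) := by
  induction k generalizing i m with
  | zero => rfl
  | succ k ih =>
    rw [stepRange, stepRange, reindex_stepSeq (skipIdx_eq_succ_iff h)]
    congr 1
    funext m
    exact ih (by omega) m

theorem stepRange_reindex_skipIdx_self {p : Polynomial ℚ} (hp : p.coeff 0 = 0) (i k : ℕ)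
    (f : ℕ → LatFun) (m : ℕ) :
    stepRange p i (k + 1) (fun m => reindex (skipIdx i) (f m)) m =
      reindex (skipIdx i) (stepRange p i k f m) := by
  rw [stepRange, stepSeq_eq_self hp, stepRange_reindex_skipIdx p le_rfl]
  intro m
  rw [stepRange_reindex_skipIdx p le_rfl]
  exact diffOp_reindex (skipIdx_ne i) 1 _

/-- The segment `v a, …, v (a + n - 1)` of a sequence. -/
def seg (v : ℕ → ℤ) (a n : ℕ) : List ℤ := (List.range' a n).map v

theorem seg_zero (v : ℕ → ℤ) (a : ℕ) : seg v a 0 = [] := rfl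

theorem seg_succ (v : ℕ → ℤ) (a n : ℕ) : seg v a (n + 1) = v a :: seg v (a + 1) n := by
  simp [seg, List.range'_succ]

theorem seg_append (v : ℕ → ℤ) (a m n : ℕ) : seg v a (m + n) = seg v a m ++ seg v (a + m) n := by
  simp [seg, ← List.map_append, List.range'_append_1]

theorem seg_congr {v v' : ℕ → ℤ} {a n : ℕ} (h : ∀ t, a ≤ t → t < a + n → v t = v' t) :
    seg v a n = seg v' a n := by
  refine List.map_congr_left fun t ht => ?_
  rw [List.mem_range'_1] at ht
  exact h t ht.1 ht.2

theorem seg_add_single {v : ℕ → ℤ} {a n s : ℕ} {c : ℤ} (h : s < a ∨ a + n ≤ s) :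
    seg (v + Pi.single s c) a n = seg v a n := by
  refine seg_congr fun t h1 h2 => ?_
  rw [Pi.add_apply, Pi.single_eq_of_ne (by omega), add_zero]

/-- The function counting Gelfand–Tsetlin trapezoids of height `h`, in shifted coordinates, as a
function of the first `n` variables. -/
def gtFun (h n : ℕ) : LatFun := fun v => gtList h (seg v 0 n)

/-- The partial interlacing sum in which the entries of `g` outside of a middle part
are specified directly. -/
def midSum (g : List ℤ → ℚ) (c k r : ℕ) : LatFun := fun v =>
  interlaceSum (fun l => g (seg v 0 c ++ (l ++ seg v (c + k + 1) r))) (seg v c (k + 1))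

theorem diffOp_smul_midSum_left (g : List ℤ → ℚ) (c k : ℕ) :
    diffOp c 1 • midSum g c (k + 1) 0 = -midSum g (c + 1) k 0 := by
  ext v
  rw [diffOp_smul_apply, LatFun.neg_apply]
  simp only [midSum, seg_succ _ c, seg_add_single (Or.inl (Nat.lt_succ_self c)),
    seg_add_single (Or.inr (Nat.zero_add c).le), Pi.add_apply, Pi.single_eq_same, seg_zero,
    List.append_nil]
  simp only [seg_succ _ (c + 1) k, interlaceSum, ssum_succ_left]
  rw [sub_sub_cancel_left]
  simp [seg_append v 0 c 1, seg_succ, seg_zero]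

theorem diffOp_smul_midSum_right (g : List ℤ → ℚ) (c k r : ℕ) :
    diffOp (c + k + 1) 1 • midSum g c (k + 1) r = midSum g c k (r + 1) := by
  have e : ∀ v, seg v c (k + 1 + 1) = seg v c k ++ [v (c + k), v (c + k + 1)] := fun v => by
    rw [add_assoc, seg_append]; simp [seg, List.range'_succ]
  have e' : ∀ v, seg v c (k + 1) = seg v c k ++ [v (c + k)] := fun v => by
    rw [seg_append]; simp [seg]
  ext v
  rw [diffOp_smul_apply]
  simp only [midSum, e, e', interlaceSum_append]
  rw [seg_add_single (by omega), seg_add_single (by omega), seg_add_single (by omega)]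
  simp only [Pi.add_apply, Pi.single_eq_same,
    Pi.single_eq_of_ne (show c + k ≠ c + k + 1 by omega), add_zero, ssum_succ_right]
  rw [add_sub_cancel_left, seg_succ]
  simp [add_assoc]

theorem leftProd_smul_midSum (g : List ℤ → ℚ) {c n : ℕ} (h : c ≤ n) :
    leftProd c • midSum g 0 n 0 = (-1 : ShiftAlg) ^ c • midSum g c (n - c) 0 := by
  induction c with
  | zero => simp [leftProd]
  | succ c ih =>
    rw [leftProd_succ, mul_smul, ih (by omega), smul_comm,
      show n - c = n - (c + 1) + 1 by omega, diffOp_smul_midSum_left, pow_succ, mul_smul,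
      neg_one_smul]

theorem rightProd_smul_midSum (g : List ℤ → ℚ) (c k r : ℕ) :
    rightProd (c + k + 1) (c + k + r + 1) • midSum g c (k + r) 0 = midSum g c k r := by
  induction r generalizing k with
  | zero => simp [rightProd]
  | succ r ih =>
    have h := ih (k + 1)
    rw [rightProd_eq_mul (by omega), mul_smul, ← diffOp_smul_midSum_right, ← h]
    congr 3 <;> ring

theorem midSum_zero (h c r : ℕ) :
    midSum (gtList h) c 0 r = reindex (skipIdx c) (gtFun h (c + r)) := by
  ext v
  have e : seg v (c + 1) r = seg (v ∘ skipIdx c) c r := by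
    simp only [seg, List.range'_eq_map_range, List.map_map]
    refine List.map_congr_left fun t _ => ?_
    simp only [Function.comp_apply, skipIdx, if_neg (show ¬ c + t < c by omega)]
    congr 1; omega
  rw [reindex_apply, gtFun, midSum, seg_append (v ∘ skipIdx c) 0 c r]
  simp only [seg_congr (v := v) (v' := v ∘ skipIdx c) (a := 0) (n := c)
    (fun t _ h => by simp [skipIdx, if_pos (show t < c by omega)])]
  simp [e, seg_succ, seg_zero, interlaceSum]

theorem prod_diffOp_smul_gtFun (h : ℕ) {n j : ℕ} (hj : j ≤ n) :
    (leftProd j * rightProd (j + 1) (n + 1)) • gtFun (h + 1) (n + 1) =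
      (-1 : ShiftAlg) ^ j • reindex (skipIdx j) (gtFun h n) := by
  have e : gtFun (h + 1) (n + 1) = midSum (gtList h) 0 n 0 := by
    ext v
    simp [gtFun, midSum, gtList, seg]
  obtain ⟨r, rfl⟩ := Nat.exists_eq_add_of_le hj
  have e2 := rightProd_smul_midSum (gtList h) j 0 r
  simp only [add_zero, zero_add] at e2
  rw [e, mul_comm, mul_smul, leftProd_smul_midSum _ hj, smul_comm, Nat.add_sub_cancel_left,
    ← midSum_zero, e2]

theorem gtFun_mem_nearAntisymm (h : ℕ) {n j : ℕ} (hj : j + 1 < n) :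
    gtFun (h + 1) n ∈ nearAntisymm j := by
  obtain ⟨f, F, hf⟩ := exists_almostAntisymm_gtList h
  have hf' := hf.interlaceSum
  obtain ⟨r, rfl⟩ : ∃ r, n = j + (2 + r) := ⟨n - j - 2, by omega⟩
  have e : ∀ v, (gtFun (h + 1) (j + (2 + r)) +
      reindex (Equiv.swap j (j + 1)) (gtFun (h + 1) (j + (2 + r)))) v =
      nextCorrection f (v (j + 1) - v j) *
        interlaceSum F (seg v 0 j ++ seg v (j + 2) r) := by
    intro v
    rw [← hf', LatFun.add_apply, reindex_apply]
    have e1 : ∀ w, seg w 0 (j + (2 + r)) = seg w 0 j ++ w j :: w (j + 1) :: seg w (j + 2) r := by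
      intro w
      rw [seg_append, seg_append]
      simp [seg, List.range'_succ]
    simp only [gtFun, gtList, e1]
    rw [seg_congr (v := v ∘ Equiv.swap j (j + 1)) (v' := v) (a := 0),
      seg_congr (v := v ∘ Equiv.swap j (j + 1)) (v' := v) (a := j + 2)]
    · simp
    · intro t h1 h2
      rw [Function.comp_apply, Equiv.swap_apply_of_ne_of_ne (by omega) (by omega)]
    · intro t h1 h2
      rw [Function.comp_apply, Equiv.swap_apply_of_ne_of_ne (by omega) (by omega)]
  refine ⟨?_, ?_⟩
  · ext v
    rw [sub_smul, one_smul, mul_smul, LatFun.sub_apply, shiftOp_smul_apply, shiftOp_smul_apply,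
      e, e, seg_add_single (by omega), seg_add_single (by omega), seg_add_single (by omega),
      seg_add_single (by omega), LatFun.zero_apply]
    simp
  · intro v hv
    rw [e, hv, sub_self, nextCorrection_zero, zero_mul]

/-- The sequence of coefficients of the powers of `z` in the image of `gtFun h n` under the
operators attached to the variables in `[i, n)`. -/
def trapSeq (p : Polynomial ℚ) (h n i : ℕ) : ℕ → LatFun :=
  stepRange p i (n - i) (Pi.single 0 (gtFun h n))

theorem smul_reindex_single (a : ShiftAlg) (σ : ℕ → ℕ) (f : LatFun) :
    (Pi.single 0 (a • reindex σ f) : ℕ → LatFun) =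
      fun m => a • reindex σ ((Pi.single 0 f : ℕ → LatFun) m) := by
  funext m
  cases m <;> simp

theorem smul_trapSeq (p : Polynomial ℚ) (h n i : ℕ) (a : ShiftAlg) (m : ℕ) :
    a • trapSeq p h n i m = stepRange p i (n - i) (Pi.single 0 (a • gtFun h n)) m := by
  rw [trapSeq, smul_stepRange]
  congr 1
  funext m
  cases m <;> simp

theorem prod_diffOp_smul_trapSeq_succ (p : Polynomial ℚ) (h : ℕ) {n i j : ℕ} (hji : j ≤ i)
    (hin : i ≤ n) (m : ℕ) :
    (leftProd j * rightProd (j + 1) (n + 1)) • trapSeq p (h + 1) (n + 1) (i + 1) m =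
      (-1 : ShiftAlg) ^ j • reindex (skipIdx j) (trapSeq p h n i m) := by
  rw [smul_trapSeq, prod_diffOp_smul_gtFun h (hji.trans hin), smul_reindex_single,
    ← smul_stepRange, stepRange_reindex_skipIdx p hji, Nat.add_sub_add_right, trapSeq]

theorem prod_diffOp_smul_trapSeq {p : Polynomial ℚ} (hp : p.coeff 0 = 0) (h : ℕ) {n i : ℕ}
    (hin : i ≤ n) (m : ℕ) :
    (leftProd i * rightProd (i + 1) (n + 1)) • trapSeq p (h + 1) (n + 1) i m =
      (-1 : ShiftAlg) ^ i • reindex (skipIdx i) (trapSeq p h n i m) := by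
  rw [smul_trapSeq, prod_diffOp_smul_gtFun h hin, smul_reindex_single,
    ← smul_stepRange, show n + 1 - i = n - i + 1 by omega, stepRange_reindex_skipIdx_self hp,
    trapSeq]

theorem trapSeq_mem_vanishing (p : Polynomial ℚ) (h : ℕ) {n i j : ℕ} (hj : j + 1 < n)
    (hij : j + 1 < i ∨ i ≤ j) (m : ℕ) : trapSeq p (h + 1) n i m ∈ vanishing j := by
  refine nearAntisymm_le_vanishing j (stepRange_mem_nearAntisymm p (fun m => ?_) (by omega) m)
  cases m with
  | zero => exact gtFun_mem_nearAntisymm h hj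
  | succ m => simp

theorem diffOp_smul_gtFun_zero (s n : ℕ) (c : ℤ) : diffOp s c • gtFun 0 n = 0 := by
  ext v
  rw [diffOp_smul_apply, LatFun.zero_apply]
  simp [gtFun, gtList]

theorem stepRange_eq_self {p : Polynomial ℚ} (hp : p.coeff 0 = 0) (i k : ℕ) {f : ℕ → LatFun}
    (hf : ∀ s m, diffOp s 1 • f m = 0) : stepRange p i k f = f := by
  induction k generalizing i with
  | zero => rfl
  | succ k ih => rw [stepRange, ih, stepSeq_eq_self hp (hf i)]

theorem trapSeq_self_eq_zero (p : Polynomial ℚ) (h n : ℕ) {m : ℕ} (hm : 0 < m) :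
    trapSeq p h n n m = 0 := by
  rw [trapSeq, Nat.sub_self, stepRange, Pi.single_eq_of_ne (by omega)]

theorem trapSeq_eq_stepSeq (p : Polynomial ℚ) (h : ℕ) {n i : ℕ} (hi : i < n) :
    trapSeq p h n i = stepSeq p i (trapSeq p h n (i + 1)) := by
  rw [trapSeq, show n - i = n - (i + 1) + 1 by omega, stepRange, trapSeq]

/-- The coefficients of `z ^ m` vanish for `m > h`. -/
theorem trapSeq_eq_zero {p : Polynomial ℚ} (hp : p.coeff 0 = 0) {h n i m : ℕ} (hin : i ≤ n)
    (hm : h < m) : trapSeq p h n i m = 0 := by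
  induction h generalizing n i m with
  | zero =>
    rw [trapSeq, stepRange_eq_self hp, Pi.single_eq_of_ne (by omega)]
    intro s m
    cases m with
    | zero => exact diffOp_smul_gtFun_zero s n 1
    | succ m => simp
  | succ h ih =>
    rcases hin.eq_or_lt with rfl | hin
    · exact trapSeq_self_eq_zero p _ _ (by omega)
    obtain ⟨n, rfl⟩ : ∃ n', n = n' + 1 := ⟨n - 1, by omega⟩
    rcases i with _ | i
    · refine eq_zero_of_rightProd (a := 0) (n := n + 1)
        (fun j _ hj => trapSeq_mem_vanishing p h hj (by omega) m) ?_
      have e := prod_diffOp_smul_trapSeq hp h (Nat.zero_le n) m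
      rw [ih (Nat.zero_le n) (by omega), map_zero, smul_zero] at e
      simpa [leftProd] using e
    · obtain ⟨m, rfl⟩ : ∃ m', m = m' + 1 := ⟨m - 1, by omega⟩
      have hl : ∀ {j l m}, j ≤ l → l ≤ n → h < m →
          (leftProd j * rightProd (j + 1) (n + 1)) • trapSeq p (h + 1) (n + 1) (l + 1) m = 0 :=
        fun hj hl hm => by
          rw [prod_diffOp_smul_trapSeq_succ p h hj hl, ih hl hm, map_zero, smul_zero]
      have e := congrFun (onePlusZ_stepSeq p (i + 1) (trapSeq p (h + 1) (n + 1) (i + 1 + 1))) (m + 1)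
      rw [← trapSeq_eq_stepSeq p _ hin] at e
      simp only [onePlusZ] at e
      have e' := congrArg (fun f => (leftProd i * rightProd (i + 2) (n + 1)) • f) e
      simp only [smul_add] at e'
      have d : ∀ {b : ShiftAlg} {l}, diffOp (i + 1) 1 ∣ b → i ≤ l → l ≤ n →
          (leftProd i * rightProd (i + 2) (n + 1)) • b • trapSeq p (h + 1) (n + 1) (l + 1) m = 0 := by
        rintro b l ⟨c, rfl⟩ hil hl'
        have := hl (m := m) hil hl' (by omega)
        rw [rightProd_eq_mul hin] at this
        rw [← mul_smul, ← smul_zero c, ← this, ← mul_smul]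
        congr 1
        ring
      have e3 : (leftProd i * rightProd (i + 2) (n + 1)) •
          trapSeq p (h + 1) (n + 1) (i + 1 + 1) (m + 1) = 0 := by
        refine eq_zero_of_vanishing_of_diffOp_left (j := i) ?_ ?_
        · rw [mul_smul]
          exact leftProd_smul_mem_vanishing le_rfl (rightProd_smul_mem_vanishing le_rfl
            (trapSeq_mem_vanishing p h hin (Or.inl (by omega)) _))
        · rw [← mul_smul, ← mul_assoc, ← leftProd_succ]
          exact hl le_rfl (by omega) (by omega)
      rw [d (diffOp_dvd_polyOp hp _ _) le_rfl (by omega),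
        d (diffOp_one_dvd_polyOp_neg_one hp _) (by omega) (by omega), e3, add_zero, add_zero,
        mul_smul] at e'
      refine eq_zero_of_rightProd (a := i + 1) (n := n + 1)
        (fun j hj hj' => trapSeq_mem_vanishing p h hj' (by omega) _) ?_
      refine eq_zero_of_leftProd (fun j hj => rightProd_smul_mem_vanishing (by omega)
        (trapSeq_mem_vanishing p h (by omega) (Or.inl (by omega)) _)) e'

theorem rightProd_smul_trapSeq {p : Polynomial ℚ} (hp : p.coeff 0 = 0) {h n i m : ℕ}
    (hin : i ≤ n) (hm : h < m) :
    rightProd (i + 1) (n + 1) • trapSeq p (h + 1) (n + 1) (i + 1) m = 0 := by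
  refine eq_zero_of_leftProd (i := i) (fun j hj => rightProd_smul_mem_vanishing (by omega)
    (trapSeq_mem_vanishing p h (by omega) (Or.inl (by omega)) _)) ?_
  rw [← mul_smul, prod_diffOp_smul_trapSeq_succ p h le_rfl hin, trapSeq_eq_zero hp hin hm,
    map_zero, smul_zero]

theorem leftProd_smul_trapSeq {p : Polynomial ℚ} (hp : p.coeff 0 = 0) {h n i m : ℕ}
    (hin : i ≤ n) (hm : h < m) : leftProd i • trapSeq p (h + 1) (n + 1) i m = 0 := by
  refine eq_zero_of_rightProd (a := i) (n := n + 1) (fun j hj hj' =>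
    leftProd_smul_mem_vanishing (by omega)
      (trapSeq_mem_vanishing p h (by omega) (Or.inr hj) _)) ?_
  rw [← mul_smul, mul_comm, prod_diffOp_smul_trapSeq hp h hin, trapSeq_eq_zero hp hin hm,
    map_zero, smul_zero]

theorem reindex_skipIdx_vanishing_left {f : LatFun} {j l : ℕ} (h : j + 1 < l)
    (hf : f ∈ vanishing j) : reindex (skipIdx l) f ∈ vanishing j := by
  intro v hv
  refine hf _ ?_
  simpa [skipIdx, h, show j < l by omega] using hv

theorem reindex_skipIdx_vanishing_right {f : LatFun} {j l : ℕ} (h : l ≤ j)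
    (hf : f ∈ vanishing j) : reindex (skipIdx l) f ∈ vanishing (j + 1) := by
  intro v hv
  refine hf _ ?_
  simpa [skipIdx, show ¬ j < l by omega, show ¬ j + 1 < l by omega] using hv

theorem reindex_skipIdx_add_mem_vanishing (f : LatFun) (j : ℕ) :
    (-1 : ℚ) ^ j • reindex (skipIdx j) f + (-1 : ℚ) ^ (j + 1) • reindex (skipIdx (j + 1)) f ∈
      vanishing j := by
  intro v hv
  have e : v ∘ skipIdx j = v ∘ skipIdx (j + 1) := by
    funext t
    simp only [Function.comp_apply, skipIdx]
    rcases lt_trichotomy t j with h | rfl | h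
    · rw [if_pos h, if_pos (by omega)]
    · simp [hv]
    · rw [if_neg (by omega), if_neg (by omega)]
  rw [LatFun.add_apply, LatFun.smul_apply, LatFun.smul_apply, reindex_apply, reindex_apply, e]
  ring

/-- The alternating sum of the functions obtained by omitting one of the variables in `T`. -/
def altSum (T : Finset ℕ) (f : LatFun) : LatFun :=
  ∑ j ∈ T, (-1 : ℚ) ^ j • reindex (skipIdx j) f

theorem altSum_mem_vanishing {T : Finset ℕ} {f : LatFun} {j : ℕ} (hj : j ∈ T) (hj' : j + 1 ∈ T)
    (hleft : ∀ l ∈ T, j + 1 < l → f ∈ vanishing j)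
    (hright : ∀ l ∈ T, l < j → reindex (skipIdx l) f ∈ vanishing j) :
    altSum T f ∈ vanishing j := by
  rw [altSum, ← Finset.add_sum_erase _ _ hj,
    ← Finset.add_sum_erase _ _ (Finset.mem_erase.mpr ⟨by omega, hj'⟩), ← add_assoc]
  refine Submodule.add_mem _ (reindex_skipIdx_add_mem_vanishing f j) (Submodule.sum_mem _ ?_)
  intro l hl
  simp only [Finset.mem_erase] at hl
  refine Submodule.smul_mem _ _ ?_
  rcases lt_or_ge l j with h | h
  · exact hright l hl.2.2 h
  · exact reindex_skipIdx_vanishing_left (by omega) (hleft l hl.2.2 (by omega))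

theorem prod_diffOp_smul_altSum {T : Finset ℕ} {i : ℕ} (hi : i ∈ T) (f : LatFun) {a : ShiftAlg}
    (ha : ∀ j ∈ T, j ≠ i → diffOp j 1 ∣ a) :
    a • altSum T f = (-1 : ℚ) ^ i • a • reindex (skipIdx i) f := by
  rw [altSum, Finset.smul_sum, Finset.sum_eq_single_of_mem i hi, smul_comm]
  intro j hj hji
  rw [smul_comm, smul_eq_zero_of_dvd (ha j hj hji) (diffOp_reindex (skipIdx_ne j) 1 f), smul_zero]

theorem leftProd_smul_reindex (i : ℕ) (f : LatFun) :
    leftProd i • reindex (skipIdx i) f = reindex (skipIdx i) (leftProd i • f) := by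
  have key : ∀ a ≤ i, leftProd a • reindex (skipIdx i) f = reindex (skipIdx i) (leftProd a • f) := by
    intro a ha
    induction a with
    | zero => simp [leftProd]
    | succ a ih =>
      rw [leftProd_succ, mul_smul, ih (by omega), mul_smul,
        reindex_diffOp (skipIdx_eq_iff (by omega))]
  exact key i le_rfl

theorem rightProd_smul_reindex (i n : ℕ) (f : LatFun) :
    rightProd (i + 1) (n + 1) • reindex (skipIdx i) f = reindex (skipIdx i) (rightProd i n • f) := by
  have key : ∀ k b, i ≤ b → n ≤ b + k →
      rightProd (b + 1) (n + 1) • reindex (skipIdx i) f = reindex (skipIdx i) (rightProd b n • f) := by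
    intro k
    induction k with
    | zero => intro b hb hn; simp [rightProd, Finset.Ico_eq_empty (show ¬ b < n by omega),
          Finset.Ico_eq_empty (show ¬ b + 1 < n + 1 by omega)]
    | succ k ih =>
      intro b hb hn
      rcases lt_or_ge b n with h | h
      · rw [rightProd_eq_mul (by omega), mul_smul, ih (b + 1) (by omega) (by omega),
          rightProd_eq_mul h, mul_smul, reindex_diffOp (skipIdx_eq_succ_iff hb)]
      · simp [rightProd, Finset.Ico_eq_empty (show ¬ b < n by omega),
          Finset.Ico_eq_empty (show ¬ b + 1 < n + 1 by omega)]
  exact key n i le_rfl (by omega)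

theorem altSum_Icc_trapSeq {p : Polynomial ℚ} (hp : p.coeff 0 = 0) {h n i m : ℕ}
    (hin : i ≤ n) (hm : h < m) :
    altSum (Finset.Icc (i + 1) (n + 1)) (trapSeq p (h + 1) (n + 1) (i + 1) m) = 0 := by
  refine eq_zero_of_rightProd (a := i + 1) (n := n + 1 + 1) (fun j hj hj' => ?_) ?_
  · refine altSum_mem_vanishing (by simp; omega) (by simp; omega) (fun l hl hjl => ?_)
      (fun l hl hjl => ?_)
    · rw [Finset.mem_Icc] at hl
      exact trapSeq_mem_vanishing p h (by omega) (Or.inr hj) m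
    · rw [Finset.mem_Icc] at hl
      obtain ⟨j, rfl⟩ : ∃ j', j = j' + 1 := ⟨j - 1, by omega⟩
      exact reindex_skipIdx_vanishing_right (by omega)
        (trapSeq_mem_vanishing p h (by omega) (Or.inr (by omega)) m)
  · rw [prod_diffOp_smul_altSum (i := i + 1) (by simp; omega), rightProd_smul_reindex,
      rightProd_smul_trapSeq hp hin hm, map_zero, smul_zero]
    intro j hj hji
    rw [Finset.mem_Icc] at hj
    exact Finset.dvd_prod_of_mem _ (by simp; omega)

theorem altSum_range_trapSeq {p : Polynomial ℚ} (hp : p.coeff 0 = 0) {h n i m : ℕ}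
    (hin : i ≤ n) (hm : h < m) :
    altSum (Finset.range (i + 1)) (trapSeq p (h + 1) (n + 1) i m) = 0 := by
  refine eq_zero_of_leftProd (i := i) (fun j hj => ?_) ?_
  · refine altSum_mem_vanishing (by simp; omega) (by simp; omega) (fun l hl hjl => ?_)
      (fun l hl hjl => ?_)
    · rw [Finset.mem_range] at hl
      exact trapSeq_mem_vanishing p h (by omega) (Or.inl (by omega)) m
    · obtain ⟨j, rfl⟩ : ∃ j', j = j' + 1 := ⟨j - 1, by omega⟩
      exact reindex_skipIdx_vanishing_right (by omega)
        (trapSeq_mem_vanishing p h (by omega) (Or.inl (by omega)) m)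
  · rw [prod_diffOp_smul_altSum (i := i) (by simp), leftProd_smul_reindex,
      leftProd_smul_trapSeq hp hin hm, map_zero, smul_zero]
    intro j hj hji
    rw [Finset.mem_range] at hj
    exact Finset.dvd_prod_of_mem _ (by simp; omega)

theorem sum_piFinset_eq_interlaceSum (g : List ℤ → ℚ) {n : ℕ} {b : Fin (n + 1) → ℤ}
    (hb : Monotone b) :
    ∑ m ∈ Fintype.piFinset (fun j : Fin n => Finset.Ico (b j.castSucc) (b j.succ)),
      g (List.ofFn m) = interlaceSum g (List.ofFn b) := by
  induction n generalizing g with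
  | zero => simp [interlaceSum]
  | succ n ih =>
    have e : Fintype.piFinset (fun j : Fin (n + 1) => Finset.Ico (b j.castSucc) (b j.succ)) =
        (Finset.Ico (b 0) (b 1) ×ˢ Fintype.piFinset (fun j : Fin n =>
          Finset.Ico (b j.castSucc.succ) (b j.succ.succ))).map
          (Fin.consEquiv fun _ : Fin (n + 1) => ℤ).toEmbedding := by
      have := Finset.filter_piFinset_eq_map_consEquiv
        (fun j : Fin (n + 1) => Finset.Ico (b j.castSucc) (b j.succ)) (fun _ => True)
      simp only [Finset.filter_true] at this
      rw [this]
      rfl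
    rw [e, Finset.sum_map, Finset.sum_product]
    have hb' : Monotone fun j : Fin (n + 1) => b j.succ :=
      fun i j hij => hb (Fin.succ_le_succ_iff.mpr hij)
    have e1 : List.ofFn b = b 0 :: b 1 :: List.ofFn (fun j : Fin n => b j.succ.succ) := by
      rw [List.ofFn_succ, List.ofFn_succ]; rfl
    rw [e1, interlaceSum, ssum_eq_sum_Ico (hb (Fin.zero_le _))]
    refine Finset.sum_congr rfl fun m _ => ?_
    have e2 : b 1 :: List.ofFn (fun j : Fin n => b j.succ.succ) =
        List.ofFn fun j : Fin (n + 1) => b j.succ := by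
      rw [List.ofFn_succ]; rfl
    rw [e2, ← ih (fun l => g (m :: l)) hb']
    refine Finset.sum_congr rfl fun m' _ => ?_
    simp [Fin.consEquiv, List.ofFn_succ]

/-- The Gelfand–Tsetlin trapezoids with bottom row `k`. -/
abbrev GTSet (h n : ℕ) (k : Fin n → ℤ) : Type :=
  {a : GTIdx h n → ℤ //
    IsGT h n a ∧ ∀ i : Fin n, a (mkIdx h n h i.val le_rfl (by have := i.isLt; omega)) = k i}

/-- Removing the bottom row of a trapezoid. -/
def GTIdx.restrict {h n : ℕ} (a : GTIdx (h + 1) (n + 1) → ℤ) : GTIdx h n → ℤ :=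
  fun x => a (mkIdx (h + 1) (n + 1) x.1.1 x.1.2 (by have := x.2; omega) (by have := x.2; omega))

/-- Adding a bottom row to a trapezoid. -/
def GTIdx.extend {h n : ℕ} (hn : h ≤ n) (a : GTIdx h n → ℤ) (k : Fin (n + 1) → ℤ) :
    GTIdx (h + 1) (n + 1) → ℤ :=
  fun x => if hx : x.1.1 ≤ h then a (mkIdx h n x.1.1 x.1.2 hx (by have := x.2; omega))
    else k ⟨x.1.2, by have := x.2; omega⟩

/-- The trapezoids with bottom row `k` correspond to the smaller trapezoids whose bottom row
interlaces with `k`. -/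
def gtSetEquiv {h n : ℕ} (hn : h ≤ n) (k : Fin (n + 1) → ℤ) :
    GTSet (h + 1) (n + 1) k ≃
      Σ m : {m // m ∈ Fintype.piFinset
        (fun j : Fin n => Finset.Icc (k j.castSucc) (k j.succ))}, GTSet h n m.1 where
  toFun a := ⟨⟨fun i => a.1 (mkIdx (h + 1) (n + 1) h i.val (by omega) (by have := i.isLt; omega)), by
      rw [Fintype.mem_piFinset]
      intro j
      have := a.2.1 h j.val (by omega) (by have := j.isLt; omega)
      rw [Finset.mem_Icc, ← a.2.2, ← a.2.2]
      exact this⟩, ⟨GTIdx.restrict a.1, fun r c hr hc =>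
        a.2.1 r c (by omega) (by omega), fun i => rfl⟩⟩
  invFun y := ⟨GTIdx.extend hn y.2.1 k, by
    obtain ⟨⟨m, hm⟩, a, ha, hbot⟩ := y
    refine ⟨fun r c hr hc => ?_, fun i => ?_⟩
    · rcases Nat.lt_or_ge r h with hr' | hr'
      · simpa [GTIdx.extend, mkIdx, hr'.le, Nat.succ_le_of_lt hr'] using
          ha r c hr' (by omega)
      · obtain rfl : r = h := by omega
        rw [Fintype.mem_piFinset] at hm
        have := hm ⟨c, by omega⟩
        rw [← show a _ = m _ from hbot _, Finset.mem_Icc] at this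
        simpa [GTIdx.extend, mkIdx] using this
    · simp [GTIdx.extend, mkIdx]⟩
  left_inv a := by
    refine Subtype.ext (funext fun x => ?_)
    obtain ⟨⟨r, c⟩, hr, hc⟩ := x
    dsimp only [GTIdx.extend]
    split_ifs with h1
    · rfl
    · obtain rfl : r = h + 1 := by simp only at hr h1; omega
      exact (a.2.2 _).symm
  right_inv y := by
    obtain ⟨⟨m, hm⟩, a, ha, hbot⟩ := y
    refine Sigma.subtype_ext ?_ ?_
    · refine Subtype.ext (funext fun i => ?_)
      rw [← hbot]
      simp [GTIdx.extend, mkIdx]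
    · refine funext fun x => ?_
      obtain ⟨⟨r, c⟩, hr, hc⟩ := x
      simp only at hr
      simp [GTIdx.extend, GTIdx.restrict, mkIdx, hr]

theorem finite_gtSet {h n : ℕ} (hn : h ≤ n) (k : Fin n → ℤ) : Finite (GTSet h n k) := by
  induction h generalizing n with
  | zero =>
    refine Finite.of_injective (β := Unit) (fun _ => ()) fun a a' _ => ?_
    refine Subtype.ext (funext fun x => ?_)
    obtain ⟨⟨r, c⟩, hr, hc⟩ := x
    obtain rfl : r = 0 := by simpa using hr
    exact (a.2.2 ⟨c, by simpa using hc⟩).trans (a'.2.2 ⟨c, by simpa using hc⟩).symm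
  | succ h ih =>
    obtain ⟨n, rfl⟩ : ∃ n', n = n' + 1 := ⟨n - 1, by omega⟩
    have := fun m => ih (n := n) (by omega) m
    exact Finite.of_equiv _ (gtSetEquiv (by omega) k).symm

theorem GTcount_succ {h n : ℕ} (hn : h ≤ n) (k : Fin (n + 1) → ℤ) :
    GTcount (h + 1) (n + 1) k =
      ∑ m ∈ Fintype.piFinset (fun j : Fin n => Finset.Icc (k j.castSucc) (k j.succ)),
        GTcount h n m := by
  have := fun m => finite_gtSet (n := n) hn m
  rw [GTcount, Nat.card_congr (gtSetEquiv hn k), Nat.card_sigma]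
  exact Finset.sum_coe_sort _ (GTcount h n)

theorem GTcount_zero (n : ℕ) (k : Fin n → ℤ) : GTcount 0 n k = 1 := by
  have := finite_gtSet (Nat.zero_le n) k
  rw [GTcount, Nat.card_eq_one_iff_unique]
  refine ⟨⟨fun a a' => Subtype.ext (funext fun x => ?_)⟩,
    ⟨fun x => k ⟨x.1.2, by have := x.2; omega⟩, fun r c hr => by omega, fun i => rfl⟩⟩
  obtain ⟨⟨r, c⟩, hr, hc⟩ := x
  obtain rfl : r = 0 := by simpa using hr
  exact (a.2.2 ⟨c, by simpa using hc⟩).trans (a'.2.2 ⟨c, by simpa using hc⟩).symm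

theorem GTcount_eq_gtList {h n : ℕ} (hn : h ≤ n) {b : Fin n → ℤ} (hb : StrictMono b) :
    (GTcount h n (fun i => b i - (i.val + 1)) : ℚ) = gtList h (List.ofFn b) := by
  induction h generalizing n with
  | zero => simp [GTcount_zero, gtList]
  | succ h ih =>
    obtain ⟨n, rfl⟩ : ∃ n', n = n' + 1 := ⟨n - 1, by omega⟩
    rw [GTcount_succ (by omega), gtList, ← sum_piFinset_eq_interlaceSum _ hb.monotone,
      Nat.cast_sum]
    symm
    refine Finset.sum_bij' (fun m _ j => m j - (j.val + 1)) (fun m _ j => m j + (j.val + 1))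
      ?_ ?_ ?_ ?_ ?_
    · intro m hm
      simp only [Fintype.mem_piFinset, Finset.mem_Ico, Finset.mem_Icc] at hm ⊢
      intro j
      have := hm j
      simp only [Fin.val_castSucc, Fin.val_succ]
      push_cast
      omega
    · intro m hm
      simp only [Fintype.mem_piFinset, Finset.mem_Ico, Finset.mem_Icc] at hm ⊢
      intro j
      have := hm j
      simp only [Fin.val_castSucc, Fin.val_succ] at this
      push_cast at this
      omega
    · intro m _; funext j; ring
    · intro m _; funext j; ring
    · intro m hm
      simp only [Fintype.mem_piFinset, Finset.mem_Ico] at hm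
      refine (ih (by omega) fun j l hjl => ?_).symm
      exact (hm j).2.trans_le ((hb.monotone (show j.succ ≤ l.castSucc from hjl)).trans (hm l).1)

theorem ofFn_eq_seg (v : ℕ → ℤ) (n : ℕ) : List.ofFn (fun j : Fin n => v j.val) = seg v 0 n := by
  exact List.ext_getElem (by simp [seg]) fun i _ _ => by simp [seg]

/-- The values at integer points of the coefficients of the powers of `z`. -/
def ev (q : Rz) (m : ℕ) : LatFun := fun v =>
  Polynomial.coeff (MvPolynomial.eval (fun u => Polynomial.C (v u : ℚ)) q) m

theorem ev_add (q r : Rz) : ev (q + r) = ev q + ev r := by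
  funext m
  ext v
  simp [ev, LatFun.add_apply]

theorem ev_sub (q r : Rz) (m : ℕ) : ev (q - r) m = ev q m - ev r m := by
  ext v
  simp [ev, LatFun.sub_apply]

theorem ev_sum {ι : Type*} (T : Finset ι) (q : ι → Rz) (m : ℕ) :
    ev (∑ t ∈ T, q t) m = ∑ t ∈ T, ev (q t) m := by
  classical
  induction T using Finset.induction_on with
  | empty => ext v; simp [ev, LatFun.zero_apply]
  | insert a T ha ih => rw [Finset.sum_insert ha, Finset.sum_insert ha, ev_add, Pi.add_apply, ih]

theorem ev_C_mul (c : ℚ) (q : Rz) (m : ℕ) :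
    ev (MvPolynomial.C (Polynomial.C c) * q) m = c • ev q m := by
  ext v
  simp [ev, LatFun.smul_apply]

theorem ev_neg_one_pow_mul (k : ℕ) (q : Rz) (m : ℕ) :
    ev ((-1 : Rz) ^ k * q) m = (-1 : ℚ) ^ k • ev q m := by
  rw [← ev_C_mul]
  simp

theorem ev_zR_pow_mul (k : ℕ) (q : Rz) (m : ℕ) :
    ev (zR ^ k * q) m = if k ≤ m then ev q (m - k) else 0 := by
  ext v
  simp only [ev, zR, map_mul, map_pow, eval_C, Polynomial.coeff_X_pow_mul']
  split_ifs <;> rfl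

theorem ev_rename (σ : ℕ → ℕ) (q : Rz) (m : ℕ) : ev (rename σ q) m = reindex σ (ev q m) := by
  ext v
  simp only [ev, reindex_apply, eval_rename]
  rfl

theorem eval_aeval (x : ℕ → Polynomial ℚ) (f : ℕ → Rz) (q : Rz) :
    eval x (aeval f q) = eval (fun t => eval x (f t)) q := by
  induction q using MvPolynomial.induction_on with
  | C a => simp
  | add q r hq hr => simp only [map_add, hq, hr]
  | mul_X q t hq => simp only [map_mul, hq, aeval_X, eval_X]

theorem polynomial_eval_aeval {S : Type*} [CommRing S] (x : S) (f : ℕ → Polynomial S)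
    (q : MvPolynomial ℕ S) :
    Polynomial.eval x (aeval f q) = eval (fun t => (f t).eval x) q := by
  induction q using MvPolynomial.induction_on with
  | C a => simp
  | add q r hq hr => simp only [map_add, Polynomial.eval_add, hq, hr]
  | mul_X q t hq => simp only [map_mul, Polynomial.eval_mul, hq, aeval_X, eval_X]

theorem ev_shiftP (s : ℕ) (q : Rz) (m : ℕ) : ev (shiftP s q) m = shiftOp s 1 • ev q m := by
  ext v
  rw [shiftOp_smul_apply]
  simp only [ev, shiftP, eval_aeval]
  congr 3
  funext t
  split_ifs with h
  · subst h; simp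
  · simp [h]

theorem ev_shiftPinv (s : ℕ) (q : Rz) (m : ℕ) :
    ev (shiftPinv s q) m = shiftOp s (-1) • ev q m := by
  ext v
  rw [shiftOp_smul_apply]
  simp only [ev, shiftPinv, eval_aeval]
  congr 3
  funext t
  split_ifs with h
  · subst h; simp [sub_eq_add_neg]
  · simp [h]

theorem ev_iterate {A : Rz → Rz} {a : ShiftAlg} (hA : ∀ q m, ev (A q) m = a • ev q m) (k : ℕ)
    (q : Rz) (m : ℕ) : ev (A^[k] q) m = a ^ k • ev q m := by
  induction k with
  | zero => simp
  | succ k ih => rw [Function.iterate_succ_apply', hA, ih, pow_succ', mul_smul]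

theorem ev_pApplyF (p : Polynomial ℚ) (s : ℕ) (q : Rz) (m : ℕ) :
    ev (pApplyF p s q) m = polyOp p s 1 • ev q m := by
  have h : ∀ q m, ev (fdiffP s q) m = diffOp s 1 • ev q m := fun q m => by
    rw [fdiffP, ev_sub, ev_shiftP, diffOp, sub_smul, one_smul]
  simp only [pApplyF, ev_sum, ev_C_mul, ev_iterate h, polyOp_smul]

theorem ev_pApplyB (p : Polynomial ℚ) (s : ℕ) (q : Rz) (m : ℕ) :
    ev (pApplyB p s q) m = polyOp p s (-1) • ev q m := by
  have h : ∀ q m, ev (bdiffP s q) m = diffOp s (-1) • ev q m := fun q m => by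
    rw [bdiffP, ev_sub, ev_shiftPinv, diffOp, sub_smul, one_smul]
  simp only [pApplyB, ev_sum, ev_C_mul, ev_iterate h, polyOp_smul]

theorem diffOp_pow_smul_ev (s : ℕ) (q : Rz) (m : ℕ) :
    diffOp s 1 ^ (q.totalDegree + 1) • ev q m = 0 := by
  ext v
  let P : Polynomial (Polynomial ℚ) := aeval (fun u => Polynomial.C (Polynomial.C (v u : ℚ)) +
    if u = s then Polynomial.X else 0) q
  have hP : P.natDegree ≤ q.totalDegree * 1 := by
    refine aeval_natDegree_le q le_rfl _ fun u => ?_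
    refine Polynomial.natDegree_add_le_of_degree_le (by simp) ?_
    split_ifs <;> simp
  have hPe : ∀ x, P.eval x = eval (fun u => Polynomial.C (v u : ℚ) + if u = s then x else 0) q := by
    intro x
    rw [polynomial_eval_aeval]
    congr 2
    funext u
    split_ifs <;> simp
  have key : ∀ (k : ℕ) (t : ℤ), (diffOp s 1 ^ k • ev q m) (v + Pi.single s t) =
      ((fwdDiff 1)^[k] P.eval (Polynomial.C (t : ℚ))).coeff m := by
    intro k
    induction k with
    | zero =>
      intro t
      simp only [pow_zero, one_smul, Function.iterate_zero, id, hPe, ev]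
      congr 3
      funext u
      by_cases h : u = s
      · subst h; simp
      · simp [h]
    | succ k ih =>
      intro t
      rw [pow_succ', mul_smul, diffOp_smul_apply, add_assoc, ← Pi.single_add, ih, ih,
        Function.iterate_succ_apply', fwdDiff, Polynomial.coeff_sub]
      simp
  have := key (q.totalDegree + 1) 0
  rw [Polynomial.fwdDiff_iter_eq_zero_of_degree_lt (by omega)] at this
  rw [LatFun.zero_apply]
  simpa using this

theorem onePlusZInv_eq_sum {A M : Type*} [CommRing A] [AddCommGroup M] [Module A M] {a : A}
    {f : ℕ → M} {D : ℕ} (hf : ∀ m, a ^ (D + 1) • f m = 0) (m : ℕ) :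
    onePlusZInv a f m =
      ∑ k ∈ Finset.range (D + 1), if k ≤ m then (-a) ^ k • f (m - k) else 0 := by
  have key : onePlusZ a (fun m => ∑ k ∈ Finset.range (D + 1),
      if k ≤ m then (-a) ^ k • f (m - k) else 0) = f := by
    funext m
    cases m with
    | zero => simp [onePlusZ]
    | succ m =>
      have h := Finset.sum_range_sub'
        (fun k => if k ≤ m + 1 then (-a) ^ k • f (m + 1 - k) else 0) (D + 1)
      have h0 : (-a) ^ (D + 1) • f (m + 1 - (D + 1)) = 0 := by
        rw [neg_pow, mul_smul, hf, smul_zero]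
      simp only [h0, ite_self, Nat.zero_le, if_true, pow_zero, one_smul, Nat.sub_zero, sub_zero] at h
      rw [← h, onePlusZ, Finset.smul_sum, ← Finset.sum_add_distrib]
      refine Finset.sum_congr rfl fun k _ => ?_
      rw [sub_eq_add_neg]
      congr 1
      by_cases hk : k ≤ m
      · rw [if_pos hk, if_pos (by omega), Nat.add_sub_add_right, pow_succ', mul_smul, neg_smul,
          neg_neg]
      · rw [if_neg hk, if_neg (by omega), smul_zero, neg_zero]
  conv_lhs => rw [← key, onePlusZInv_onePlusZ]

theorem ev_geomInv {p : Polynomial ℚ} (hp : p.coeff 0 = 0) (s : ℕ) (q : Rz) :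
    ev (geomInv p s q) = onePlusZInv (polyOp p s 1) (ev q) := by
  funext m
  rw [onePlusZInv_eq_sum (D := q.totalDegree)
    (fun m => smul_eq_zero_of_dvd (pow_dvd_pow_of_dvd (diffOp_dvd_polyOp hp s 1) _)
      (diffOp_pow_smul_ev s q m)), geomInv, ev_sum]
  refine Finset.sum_congr rfl fun k _ => ?_
  rw [mul_assoc, ev_neg_one_pow_mul, ev_zR_pow_mul]
  split_ifs with h
  · rw [ev_iterate (ev_pApplyF p s), neg_pow (polyOp p s 1), mul_smul]
    rcases Nat.even_or_odd k with h2 | h2 <;> simp only [h2.neg_one_pow, neg_smul, one_smul]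
  · rw [smul_zero]

theorem ev_stepOp {p : Polynomial ℚ} (hp : p.coeff 0 = 0) (s : ℕ) (q : Rz) :
    ev (stepOp p s q) = stepSeq p s (ev q) := by
  funext m
  rw [stepOp, ev_add, stepSeq, ratioOp, ← ev_geomInv hp, Pi.add_apply]
  have h := ev_zR_pow_mul 1 (pApplyB p s (geomInv p s q)) m
  rw [pow_one] at h
  rw [h]
  cases m with
  | zero => simp [onePlusZ]
  | succ m => simp [onePlusZ, ev_pApplyB]

theorem ev_map_C (g : MvPolynomial ℕ ℚ) :
    ev (MvPolynomial.map (Polynomial.C : ℚ →+* Polynomial ℚ) g) =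
      Pi.single 0 (fun v => eval (fun u => (v u : ℚ)) g) := by
  have e : ∀ v : ℕ → ℤ, eval (fun u => Polynomial.C (v u : ℚ))
      (MvPolynomial.map (Polynomial.C : ℚ →+* Polynomial ℚ) g) =
      Polynomial.C (eval (fun u => (v u : ℚ)) g) := by
    intro v
    induction g using MvPolynomial.induction_on with
    | C a => simp
    | add q r hq hr => simp only [map_add, hq, hr]
    | mul_X q t hq => simp only [map_mul, hq, map_X, eval_X]
  funext m
  ext v
  simp only [ev, e, Polynomial.coeff_C]
  cases m <;> rfl

theorem ev_Qop {p : Polynomial ℚ} (hp : p.coeff 0 = 0) (n i : ℕ) (g : MvPolynomial ℕ ℚ) :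
    ev (Qop n i p g) =
      stepRange p i (n - i) (Pi.single 0 (fun v => eval (fun u => (v u : ℚ)) g)) := by
  have key : ∀ k i q, ev ((List.range k).foldr (fun t q => stepOp p (i + t) q) q) =
      stepRange p i k (ev q) := by
    intro k
    induction k with
    | zero => intro i q; rfl
    | succ k ih =>
      intro i q
      rw [List.range_succ_eq_map, List.foldr_cons, List.foldr_map, ev_stepOp hp, stepRange, ← ih]
      simp only [Nat.succ_eq_add_one, add_zero, add_assoc, add_comm 1]
  rw [Qop, key, ev_map_C]

/-- Functions that vanish whenever the gaps between the first `n` variables are large enough. -/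
def eventuallyZero (n : ℕ) : Submodule ℚ LatFun where
  carrier := {f | ∃ c : ℕ, ∀ v : ℕ → ℤ, (∀ s, s + 1 < n → v s + c ≤ v (s + 1)) → f v = 0}
  add_mem' := by
    rintro f g ⟨c, hc⟩ ⟨d, hd⟩
    refine ⟨c + d, fun v hv => ?_⟩
    rw [LatFun.add_apply, hc v fun s hs => ?_, hd v fun s hs => ?_, add_zero] <;>
    · have := hv s hs
      push_cast at this
      omega
  zero_mem' := ⟨0, fun _ _ => rfl⟩
  smul_mem' := by
    rintro a f ⟨c, hc⟩
    exact ⟨c, fun v hv => by rw [LatFun.smul_apply, hc v hv, mul_zero]⟩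

theorem shiftOp_smul_mem_eventuallyZero {n : ℕ} (s : ℕ) (a : ℤ) (f : LatFun)
    (hf : f ∈ eventuallyZero n) : shiftOp s a • f ∈ eventuallyZero n := by
  obtain ⟨c, hc⟩ := hf
  refine ⟨c + a.natAbs, fun v hv => ?_⟩
  rw [shiftOp_smul_apply]
  refine hc _ fun t ht => ?_
  have := hv t ht
  push_cast at this
  have h1 := le_abs_self a
  have h2 := neg_abs_le a
  simp only [Pi.add_apply, Pi.single_apply]
  split_ifs <;> linarith [abs_nonneg a]

theorem reindex_skipIdx_mem_eventuallyZero {n : ℕ} (j : ℕ) {f : LatFun}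
    (hf : f ∈ eventuallyZero n) : reindex (skipIdx j) f ∈ eventuallyZero (n + 1) := by
  obtain ⟨c, hc⟩ := hf
  refine ⟨c, fun v hv => hc _ fun t ht => ?_⟩
  have h1 := hv t (by omega)
  have h2 := hv (t + 1) (by omega)
  simp only [Function.comp_apply, skipIdx]
  split_ifs <;> omega

theorem eval_eq_zero_of_mem_eventuallyZero {n : ℕ} {g : MvPolynomial ℕ ℚ}
    (hg : (fun v => eval (fun u => (v u : ℚ)) g : LatFun) ∈ eventuallyZero n) : g = 0 := by
  obtain ⟨c, hc⟩ := hg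
  refine funext_set (fun _ => Set.range ((↑) : ℤ → ℚ))
    (fun _ => Set.infinite_range_of_injective Int.cast_injective) fun x hx => ?_
  choose w hw using fun u => hx u (Set.mem_univ u)
  obtain rfl : (fun u => (w u : ℚ)) = x := funext hw
  rw [map_zero]
  let R : Polynomial ℚ :=
    aeval (fun u => Polynomial.C (w u : ℚ) + Polynomial.C (u : ℚ) * Polynomial.X) g
  have hR : ∀ t, R.eval t = eval (fun u => (w u : ℚ) + u * t) g := by
    intro t
    rw [polynomial_eval_aeval]
    simp
  obtain ⟨T, hT⟩ := ((Finset.range n).image fun s => w s + c - w (s + 1)).exists_le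
  have hR0 : R = 0 := by
    refine Polynomial.eq_zero_of_infinite_isRoot R (Set.Infinite.mono ?_
      ((Set.Ici_infinite T).image (Int.cast_injective (α := ℚ)).injOn))
    rintro _ ⟨t, ht, rfl⟩
    have h := hc (fun u => w u + u * t) fun s hs => by
      have := hT _ (Finset.mem_image_of_mem _ (Finset.mem_range.mpr (show s < n by omega)))
      rw [Set.mem_Ici] at ht
      push_cast
      linarith
    simp only [Set.mem_ofPred_eq, Polynomial.IsRoot, hR]
    simpa using h
  have := hR 0
  simpa [hR0] using this.symm

theorem coeff_coeff_eq_zero_of_ev_mem {n m : ℕ} {q : Rz} (hq : ev q m ∈ eventuallyZero n)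
    (d : ℕ →₀ ℕ) : Polynomial.coeff (MvPolynomial.coeff d q) m = 0 := by
  let g : MvPolynomial ℕ ℚ := ∑ d ∈ q.support, monomial d ((coeff d q).coeff m)
  have hg : ev q m = fun v => eval (fun u => (v u : ℚ)) g := by
    ext v
    rw [ev, eval_eq]
    simp only [g, map_sum, Polynomial.finsetSum_coeff, ← Polynomial.C_pow, ← map_prod,
      Polynomial.coeff_mul_C, eval_monomial]
    rfl
  rw [hg] at hq
  have h := congrArg (coeff d) (eval_eq_zero_of_mem_eventuallyZero hq)
  simp only [g, coeff_sum, coeff_monomial, Finset.sum_ite_eq', coeff_zero] at h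
  by_cases hd : d ∈ q.support
  · rwa [if_pos hd] at h
  · rw [notMem_support_iff.mp hd, Polynomial.coeff_zero]

theorem ev_Qop_sub_trapSeq_mem {n h : ℕ} (hhn : h ≤ n) {p : Polynomial ℚ} (hp : p.coeff 0 = 0)
    {Gb : MvPolynomial ℕ ℚ}
    (hGb : ∀ v : ℕ → ℤ, (∀ s t : ℕ, s < t → t < n → v s < v t) →
      MvPolynomial.eval (fun u => (v u : ℚ)) Gb =
        (GTcount h n (fun idx : Fin n => v idx.val - (idx.val + 1)) : ℚ)) (i m : ℕ) :
    ev (Qop n i p Gb) m - trapSeq p h n i m ∈ eventuallyZero n := by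
  let G : LatFun := fun v => eval (fun u => (v u : ℚ)) Gb
  have hG : G - gtFun h n ∈ eventuallyZero n := by
    refine ⟨1, fun v hv => ?_⟩
    have hlt : ∀ s t : ℕ, s < t → t < n → v s < v t := by
      intro s t hst ht
      induction t, hst using Nat.le_induction with
      | base => change v s < v (s + 1); have := hv s ht; push_cast at this; omega
      | succ t _ ih => have := hv t ht; have := ih (by omega); push_cast at *; omega
    have hmono : StrictMono fun j : Fin n => v j.val := fun a b hab => hlt a b hab b.isLt
    rw [LatFun.sub_apply, sub_eq_zero, gtFun, ← ofFn_eq_seg, ← GTcount_eq_gtList hhn hmono]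
    exact hGb v hlt
  have e : (Pi.single 0 G : ℕ → LatFun) = Pi.single 0 (gtFun h n) + Pi.single 0 (G - gtFun h n) := by
    rw [← Pi.single_add, add_sub_cancel]
  rw [ev_Qop hp, show (Pi.single 0 fun v => _ : ℕ → LatFun) = Pi.single 0 G from rfl, e,
    stepRange_add, Pi.add_apply, trapSeq, add_sub_cancel_left]
  refine stepRange_mem shiftOp_smul_mem_eventuallyZero p i _ (fun m => ?_) m
  cases m with
  | zero => exact hG
  | succ m => exact Submodule.zero_mem _

theorem altSum_sub (T : Finset ℕ) (f g : LatFun) : altSum T (f - g) = altSum T f - altSum T g := by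
  simp only [altSum, map_sub, smul_sub, Finset.sum_sub_distrib]

theorem altSum_mem_eventuallyZero {n : ℕ} (T : Finset ℕ) {f g : LatFun}
    (h : f - g ∈ eventuallyZero n) (hg : altSum T g = 0) : altSum T f ∈ eventuallyZero (n + 1) := by
  rw [← sub_zero (altSum T f), ← hg, ← altSum_sub]
  exact Submodule.sum_mem _ fun j _ =>
    Submodule.smul_mem _ _ (reindex_skipIdx_mem_eventuallyZero j h)

theorem ev_sum_rename_skipIdx (T : Finset ℕ) (q : Rz) (m : ℕ) :
    ev (∑ j ∈ T, (-1 : Rz) ^ j * rename (skipIdx j) q) m = altSum T (ev q m) := by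
  simp only [ev_sum, ev_neg_one_pow_mul, ev_rename, altSum]

/-- With `Gb = ḠT_h` (characterized by
`Gb(k_1,…,k_n) = GT_h(k_1-1,…,k_n-n)` for `k_1 < ⋯ < k_n`), `p(0) = 0`,
`Q := ∏_{j=i+1}^n [(1+p(δ_{k_j})z)(1+p(Δ_{k_j})z)⁻¹] Gb`:
(a) the degree of `Q` in `z` is at most `h`;
(b) the degree in `z` of `Σ_{j=i+1}^{n+1} (-1)^j Q(z; k_1,…,k̂_j,…,k_{n+1})` is `< h`;
(c) the degree in `z` of `Σ_{j=0}^{i} (-1)^j Q(z; k_0,…,k̂_j,…,k_n)` is `< h`.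
Deleting the `j`-th entry of an `(n+1)`-tuple of variables corresponds to a renaming of
variables; "degree in `z` ≤ D" means every coefficient of `z^m` with `m > D` of every
monomial coefficient vanishes. -/
theorem statement19 (n h : ℕ) (hh : 1 ≤ h) (hhn : h ≤ n) (heven : Even (n + h))
    (i : ℕ) (hi1 : 1 ≤ i) (hi2 : i ≤ n - 1)
    (p : Polynomial ℚ) (hp : p.coeff 0 = 0)
    (Gb : MvPolynomial ℕ ℚ)
    (hGb : ∀ v : ℕ → ℤ, (∀ s t : ℕ, s < t → t < n → v s < v t) →
      MvPolynomial.eval (fun u => (v u : ℚ)) Gb =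
        (GTcount h n (fun idx : Fin n => v idx.val - (idx.val + 1)) : ℚ)) :
    (∀ (d : ℕ →₀ ℕ) (m : ℕ), h < m →
      Polynomial.coeff (MvPolynomial.coeff d (Qop n i p Gb)) m = 0) ∧
    (∀ (d : ℕ →₀ ℕ) (m : ℕ), h ≤ m →
      Polynomial.coeff
        (MvPolynomial.coeff d
          (∑ j ∈ Finset.Icc (i + 1) (n + 1),
            (-1 : Rz) ^ j *
              rename (fun t => if t < j - 1 then t else t + 1) (Qop n i p Gb))) m = 0) ∧
    (∀ (d : ℕ →₀ ℕ) (m : ℕ), h ≤ m →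
      Polynomial.coeff
        (MvPolynomial.coeff d
          (∑ j ∈ Finset.range (i + 1),
            (-1 : Rz) ^ j *
              rename (fun t => if t < j then t else t + 1) (Qop n i p Gb))) m = 0) := by
  obtain ⟨h, rfl⟩ : ∃ h', h = h' + 1 := ⟨h - 1, by omega⟩
  obtain ⟨n, rfl⟩ : ∃ n', n = n' + 1 := ⟨n - 1, by omega⟩
  obtain ⟨i, rfl⟩ : ∃ i', i = i' + 1 := ⟨i - 1, by omega⟩
  have key := fun m => ev_Qop_sub_trapSeq_mem hhn hp hGb (i + 1) m
  refine ⟨fun d m hm => ?_, fun d m hm => ?_, fun d m hm => ?_⟩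
  · refine coeff_coeff_eq_zero_of_ev_mem (n := n + 1) ?_ d
    simpa [trapSeq_eq_zero hp (show i + 1 ≤ n + 1 by omega) hm] using key m
  · have e : ∑ j ∈ Finset.Icc (i + 1 + 1) (n + 1 + 1), (-1 : Rz) ^ j *
        rename (fun t => if t < j - 1 then t else t + 1) (Qop (n + 1) (i + 1) p Gb) =
        (-1 : Rz) ^ 1 * ∑ j ∈ Finset.Icc (i + 1) (n + 1), (-1 : Rz) ^ j *
          rename (skipIdx j) (Qop (n + 1) (i + 1) p Gb) := by
      rw [← Finset.map_add_right_Icc (i + 1) (n + 1) 1, Finset.sum_map, Finset.mul_sum]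
      refine Finset.sum_congr rfl fun j _ => ?_
      rw [addRightEmbedding_apply, ← mul_assoc, ← pow_add, add_comm 1 j]
      rfl
    refine coeff_coeff_eq_zero_of_ev_mem (n := n + 1 + 1) ?_ d
    rw [e, ev_neg_one_pow_mul, ev_sum_rename_skipIdx]
    exact Submodule.smul_mem _ _ (altSum_mem_eventuallyZero _ (key m)
      (altSum_Icc_trapSeq hp (by omega) hm))
  · refine coeff_coeff_eq_zero_of_ev_mem (n := n + 1 + 1) ?_ d
    have e := ev_sum_rename_skipIdx (Finset.range (i + 1 + 1)) (Qop (n + 1) (i + 1) p Gb) m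
    exact e ▸ altSum_mem_eventuallyZero _ (key m) (altSum_range_trapSeq hp (by omega) hm)
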